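/- arXiv:0906.5185 — 3 statements merged into one kernel-verified Lean document; each statement's English description precedes it below -/
import Mathlib

section
/- The algebra P_N of multi-symmetric polynomials is a free module of rank N! over its subalgebra generated by the symmetric polynomials in z_1,…,z_N together with the symmetric polynomials in λ_1,…,λ_N. -/
open MvPolynomial

noncomputable section

abbrev Rzl (N : ℕ) := MvPolynomial (Fin N ⊕ Fin N) ℂ

def permHat (N : ℕ) (σ : Equiv.Perm (Fin N)) : Rzl N ≃ₐ[ℂ] Rzl N :=
  renameEquiv ℂ (Equiv.sumCongr σ σ)

def PN (N : ℕ) : Subalgebra ℂ (Rzl N) :=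
  ⨅ σ : Equiv.Perm (Fin N), AlgHom.equalizer (permHat N σ).toAlgHom (AlgHom.id ℂ (Rzl N))

def symGens (N : ℕ) : Set (PN N) :=
  {p | ∃ q : MvPolynomial (Fin N) ℂ, q.IsSymmetric ∧
        ((p : Rzl N) = rename Sum.inl q ∨ (p : Rzl N) = rename Sum.inr q)}

universe u

open Polynomial Pointwise in
theorem exists_finset_span_eq_adjoin_roots {S : Type u} [CommRing S] (n : ℕ) :
    ∀ (R : Type u) [CommRing R] [Algebra R S] (r : Fin n → S) (f : R[X]), f.Monic →
      f.map (algebraMap R S) = ∏ i, (Polynomial.X - Polynomial.C (r i)) →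
      ∃ s : Finset S, s.card ≤ n.factorial ∧
        Submodule.span R (s : Set S) =
          Subalgebra.toSubmodule (Algebra.adjoin R (Set.range r)) := by
  induction n with
  | zero =>
    intro R _ _ r f _ _
    exact ⟨{1}, by simp, by simp [Set.range_eq_empty, Algebra.toSubmodule_bot,
      Submodule.one_eq_span]⟩
  | succ n ih =>
    intro R _ _ r f hf hfr
    classical
    rcases subsingleton_or_nontrivial S with _ | _
    · exact ⟨∅, by simp, Subsingleton.elim _ _⟩
    have : Nontrivial R := (algebraMap R S).domain_nontrivial
    let R' := Algebra.adjoin R {r 0}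
    let x : R' := ⟨r 0, Algebra.self_mem_adjoin_singleton R (r 0)⟩
    have hdeg : f.natDegree = n + 1 := by
      rw [← hf.natDegree_map (algebraMap R S), hfr, natDegree_finsetProd_X_sub_C_eq_card]
      simp
    have hx0 : aeval (r 0) f = 0 := by
      rw [Polynomial.aeval_def, ← Polynomial.eval_map, hfr, Polynomial.eval_prod]
      exact Finset.prod_eq_zero (Finset.mem_univ 0) (by simp)
    have hx : aeval x f = 0 := by
      apply Subtype.val_injective
      have := Subalgebra.aeval_coe R' x f
      rw [← this]
      exact hx0
    obtain ⟨g, hg⟩ : (Polynomial.X - Polynomial.C x) ∣ f.map (algebraMap R R') := by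
      rw [dvd_iff_isRoot, IsRoot, Polynomial.eval_map, ← Polynomial.aeval_def, hx]
    have hgm : g.Monic :=
      (monic_X_sub_C x).of_mul_monic_left (hg ▸ hf.map _)
    have hgr : g.map (algebraMap R' S) = ∏ i, (Polynomial.X - Polynomial.C (Fin.tail r i)) := by
      apply (monic_X_sub_C (r 0)).isRegular.left
      have h := congrArg (Polynomial.map (algebraMap R' S)) hg
      rw [Polynomial.map_map, ← IsScalarTower.algebraMap_eq, hfr, Fin.prod_univ_succ] at h
      simpa [Fin.tail, x] using h.symm
    obtain ⟨t, htc, ht⟩ := ih R' (Fin.tail r) g hgm hgr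
    let s : Finset R' := (Finset.range (n + 1)).image (x ^ ·)
    have hs : Submodule.span R (s : Set R') = ⊤ := by
      have h := Submodule.span_range_natDegree_eq_adjoin hf hx
      have htop : Algebra.adjoin R {x} = ⊤ := by
        rw [← Algebra.adjoin_adjoin_coe_preimage]
        congr 1
        ext y
        simp [x, Subtype.ext_iff]
      rw [hdeg, htop, Algebra.top_toSubmodule] at h
      convert h
      rfl
    refine ⟨s • t, ?_, ?_⟩
    · rw [Nat.factorial_succ]
      refine Finset.card_smul_le.trans (Nat.mul_le_mul (Finset.card_image_le.trans ?_) htc)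
      simp
    · rw [Finset.coe_smul, Submodule.span_smul_of_span_eq_top hs, ht]
      have h := Algebra.adjoin_union_eq_adjoin_adjoin R {r 0} (Set.range (Fin.tail r))
      have hr : Set.range r = {r 0} ∪ Set.range (Fin.tail r) := by
        rw [← Set.insert_eq, ← Fin.range_cons, Fin.cons_self_tail]
      rw [hr, h]
      rfl

section Graded

variable {σ : Type*}

theorem homogeneousComponent_mul_of_isHomogeneous {R : Type*} [CommSemiring R]
    {a : MvPolynomial σ R} {i : ℕ} (ha : a.IsHomogeneous i) (b : MvPolynomial σ R) (n : ℕ) :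
    homogeneousComponent n (a * b) =
      if i ≤ n then a * homogeneousComponent (n - i) b else 0 := by
  conv_lhs => rw [← sum_homogeneousComponent b, Finset.mul_sum, map_sum]
  have h (j : ℕ) : homogeneousComponent n (a * homogeneousComponent j b) =
      if i + j = n then a * homogeneousComponent j b else 0 := by
    rw [homogeneousComponent_of_mem (ha.mul (homogeneousComponent_isHomogeneous j b))]
    simp [eq_comm]
  simp only [h]
  split_ifs with hin
  · rw [Finset.sum_eq_single (n - i)]
    · simp [hin]
    · intro j _ hj
      rw [if_neg (by omega)]
    · intro hj
      rw [if_pos (by omega), homogeneousComponent_eq_zero _ _ (by simp at hj; omega), mul_zero]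
  · exact Finset.sum_eq_zero fun j _ => if_neg (by omega)

variable {A : Type*} [CommRing A] {k : Type*} [Field k] [Algebra k A]
  [Algebra A (MvPolynomial σ k)] [IsScalarTower k A (MvPolynomial σ k)]

variable (A σ k) in
/-- The ideal of `MvPolynomial σ k` generated by the homogeneous elements of positive degree
coming from `A`. -/
def irrelevantExtension : Ideal (MvPolynomial σ k) :=
  Ideal.span {x | x ∈ Set.range (algebraMap A (MvPolynomial σ k)) ∧ ∃ i > 0, x.IsHomogeneous i}

theorem span_eq_top_of_isHomogeneous {E : Set (MvPolynomial σ k)}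
    (hE : ∀ x ∈ E, ∃ n, x.IsHomogeneous n)
    (hspan : ⊤ ≤ Submodule.span k E ⊔ (irrelevantExtension σ A k).restrictScalars k) :
    Submodule.span A E = ⊤ := by
  have key (n : ℕ) (x : MvPolynomial σ k) :
      homogeneousComponent n x ∈ Submodule.span A E := by
    induction n using Nat.strong_induction_on generalizing x with
    | _ n ih =>
      let T : Submodule k (MvPolynomial σ k) :=
        ((Submodule.span A E).restrictScalars k).comap (homogeneousComponent n)
      suffices h : Submodule.span k E ⊔ (irrelevantExtension σ A k).restrictScalars k ≤ T from
        h (hspan Submodule.mem_top)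
      refine sup_le (Submodule.span_le.2 fun e he => ?_) fun y hy => ?_
      · obtain ⟨m, hm⟩ := hE e he
        change homogeneousComponent n e ∈ Submodule.span A E
        rw [homogeneousComponent_of_mem hm]
        split_ifs
        · exact Submodule.subset_span he
        · exact zero_mem _
      · change y ∈ Ideal.span _ at hy
        change homogeneousComponent n y ∈ Submodule.span A E
        suffices h : ∀ z, homogeneousComponent n (y * z) ∈ Submodule.span A E by
          simpa using h 1
        induction hy using Submodule.span_induction with
        | mem y h =>
          obtain ⟨⟨a, rfl⟩, i, hi, hai⟩ := h
          intro z
          rw [homogeneousComponent_mul_of_isHomogeneous hai]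
          split_ifs with hin
          · rw [← Algebra.smul_def]
            exact Submodule.smul_mem _ _ (ih (n - i) (by omega) z)
          · exact zero_mem _
        | zero => simp
        | add x y _ _ hx hy =>
          intro z
          rw [add_mul, map_add]
          exact add_mem (hx z) (hy z)
        | smul c y _ hy =>
          intro z
          rw [smul_eq_mul, mul_comm c, mul_assoc]
          exact hy _
  rw [eq_top_iff]
  intro x _
  rw [← sum_homogeneousComponent x]
  exact sum_mem fun i _ => key i x

variable (hA : ∀ (a : A) (n : ℕ),
  homogeneousComponent n (algebraMap A (MvPolynomial σ k) a) ∈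
    Set.range (algebraMap A (MvPolynomial σ k)))

include hA

omit [Algebra k A] [IsScalarTower k A (MvPolynomial σ k)] in
theorem span_mk_eq_top {s : Set (MvPolynomial σ k)} (hs : Submodule.span A s = ⊤) :
    Submodule.span k s ⊔ (irrelevantExtension σ A k).restrictScalars k = ⊤ := by
  rw [eq_top_iff]
  intro x _
  have hx : x ∈ Submodule.span A s := hs ▸ Submodule.mem_top
  induction hx using Submodule.span_induction with
  | mem x h => exact Submodule.mem_sup_left (Submodule.subset_span h)
  | zero => exact zero_mem _
  | add x y _ _ hx hy => exact add_mem (hx trivial) (hy trivial)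
  | smul a x _ hx =>
    rw [Algebra.smul_def, ← sum_homogeneousComponent (algebraMap A _ a), Finset.sum_mul]
    refine sum_mem fun i _ => ?_
    rcases Nat.eq_zero_or_pos i with rfl | hi
    · rw [homogeneousComponent_zero, ← smul_eq_C_mul]
      exact Submodule.smul_mem _ _ (hx trivial)
    · refine Submodule.mem_sup_right (Ideal.mul_mem_right _ _ (Ideal.subset_span ?_))
      exact ⟨hA a i, i, hi, homogeneousComponent_isHomogeneous _ _⟩

open Module in
theorem free_range_of_isHomogeneous {s : Finset (MvPolynomial σ k)}
    (hs : Submodule.span A (s : Set (MvPolynomial σ k)) = ⊤)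
    (hcard : s.card ≤ finrank A (MvPolynomial σ k))
    (ρ : MvPolynomial σ k →ₗ[A] MvPolynomial σ k) (hρ : ∀ x, ρ (ρ x) = ρ x)
    (hρh : ∀ x n, x.IsHomogeneous n → (ρ x).IsHomogeneous n) :
    Module.Free A (LinearMap.range ρ) := by
  let I := (irrelevantExtension σ A k).restrictScalars k
  let H : Set (MvPolynomial σ k) :=
    {x | (∃ n, x.IsHomogeneous n) ∧ (ρ x = x ∨ ρ x = 0)}
  have hH : Submodule.span k H = ⊤ := by
    rw [eq_top_iff]
    intro x _
    rw [← sum_homogeneousComponent x]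
    refine sum_mem fun i _ => ?_
    have hi := homogeneousComponent_isHomogeneous i x
    rw [← add_sub_cancel (ρ (homogeneousComponent i x)) (homogeneousComponent i x)]
    refine add_mem (Submodule.subset_span ⟨⟨i, hρh _ _ hi⟩, .inl (hρ _)⟩)
      (Submodule.subset_span ⟨⟨i, hi.sub (hρh _ _ hi)⟩, .inr ?_⟩)
    rw [map_sub, hρ, sub_self]
  have hmk {t : Set (MvPolynomial σ k)} :
      Submodule.span k (I.mkQ '' t) = ⊤ ↔ Submodule.span k t ⊔ I = ⊤ := by
    rw [← Submodule.map_span, Submodule.map_mkQ_eq_top, sup_comm]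
  classical
  have hsI : Submodule.span k ((s.image I.mkQ : Finset _) : Set (_ ⧸ I)) = ⊤ := by
    rw [Finset.coe_image]
    exact hmk.2 (span_mk_eq_top hA hs)
  have hfin : Module.Finite k (_ ⧸ I) := ⟨⟨_, hsI⟩⟩
  have hdim : finrank k (_ ⧸ I) ≤ s.card := by
    have h := finrank_span_finset_le_card (R := k) (s.image I.mkQ)
    rw [Set.finrank, hsI, finrank_top] at h
    exact h.trans Finset.card_image_le
  obtain ⟨b, hbH, hbspan, hbli⟩ := exists_linearIndependent k (I.mkQ '' H)
  have hHI : Submodule.span k (I.mkQ '' H) = ⊤ := hmk.2 (by rw [hH, top_sup_eq])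
  choose e he hemk using fun x : b => hbH x.2
  have : Fintype b := @Fintype.ofFinite b hbli.finite
  have hb_card : Fintype.card b ≤ finrank A (MvPolynomial σ k) :=
    hbli.fintype_card_le_finrank.trans (hdim.trans hcard)
  have hespan : Submodule.span A (Set.range e) = ⊤ := by
    apply span_eq_top_of_isHomogeneous (k := k)
    · rintro _ ⟨x, rfl⟩
      exact (he x).1
    · refine (hmk.1 ?_).ge
      rw [← Set.range_comp]
      have : I.mkQ ∘ e = ((↑) : b → _) := funext hemk
      rw [this, Subtype.range_coe, hbspan, hHI]
  have heli : LinearIndependent A e :=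
    linearIndependent_of_top_le_span_of_card_le_finrank hespan.ge hb_card
  have hrange : LinearMap.range ρ =
      Submodule.span A (Set.range fun x : {x : b // ρ (e x) = e x} => e x) := by
    apply le_antisymm
    · rw [LinearMap.range_eq_map, ← hespan, Submodule.map_span, Submodule.span_le]
      rintro _ ⟨_, ⟨x, rfl⟩, rfl⟩
      rcases (he x).2 with h | h
      · rw [h]
        exact Submodule.subset_span ⟨⟨x, h⟩, rfl⟩
      · rw [h]
        exact zero_mem _
    · rw [Submodule.span_le]
      rintro _ ⟨x, rfl⟩
      exact ⟨_, x.2⟩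
  rw [hrange]
  exact .of_basis (Basis.span (heli.comp _ Subtype.val_injective))

end Graded

theorem sum_rename_perm_isSymmetric {σ R : Type*} [CommSemiring R] [Fintype σ] [DecidableEq σ]
    (p : MvPolynomial σ R) : (∑ e : Equiv.Perm σ, rename e p).IsSymmetric := by
  intro f
  rw [map_sum]
  simp only [rename_rename]
  exact Fintype.sum_equiv (Equiv.mulLeft f) _ _ fun e => rfl

theorem span_rename_inl_mul_rename_inr {σ τ R : Type*} [CommSemiring R] :
    Submodule.span R {x : MvPolynomial (σ ⊕ τ) R |
      ∃ p q, x = rename Sum.inl p * rename Sum.inr q} = ⊤ := by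
  rw [eq_top_iff]
  suffices h : ∀ x, x ∈ _ from fun x _ => h x
  intro x
  induction x using MvPolynomial.induction_on with
  | C a => exact Submodule.subset_span ⟨C a, 1, by simp⟩
  | add x y hx hy => exact add_mem hx hy
  | mul_X x i hx =>
    induction hx using Submodule.span_induction with
    | mem x h =>
      obtain ⟨p, q, rfl⟩ := h
      rcases i with i | i
      · exact Submodule.subset_span ⟨p * X i, q, by simp; ring⟩
      · exact Submodule.subset_span ⟨p, q * X i, by simp; ring⟩
    | zero => simp
    | add x y _ _ hx hy => rw [add_mul]; exact add_mem hx hy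
    | smul a x _ hx => rw [smul_mul_assoc]; exact Submodule.smul_mem _ a hx

section

variable {N : ℕ}

theorem mem_PN {x : Rzl N} :
    x ∈ PN N ↔ ∀ e : Equiv.Perm (Fin N), rename (Sum.map e e) x = x := by
  simp only [PN, Algebra.mem_iInf, AlgHom.mem_equalizer]
  rfl

variable (N) in
/-- The subalgebra of `PN N` generated by the symmetric polynomials in either set of variables. -/
abbrev symSubalgebra : Subalgebra ℂ (PN N) := Algebra.adjoin ℂ (symGens N)

theorem rename_inl_mem_PN {q : MvPolynomial (Fin N) ℂ} (hq : q.IsSymmetric) :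
    rename Sum.inl q ∈ PN N := by
  refine mem_PN.2 fun e => ?_
  conv_rhs => rw [← hq e, rename_rename]
  rw [rename_rename]
  rfl

theorem rename_inr_mem_PN {q : MvPolynomial (Fin N) ℂ} (hq : q.IsSymmetric) :
    rename Sum.inr q ∈ PN N := by
  refine mem_PN.2 fun e => ?_
  conv_rhs => rw [← hq e, rename_rename]
  rw [rename_rename]
  rfl

theorem rename_inl_mem_range {q : MvPolynomial (Fin N) ℂ} (hq : q.IsSymmetric) :
    rename Sum.inl q ∈ (algebraMap (symSubalgebra N) (Rzl N)).rangeS :=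
  ⟨⟨⟨_, rename_inl_mem_PN hq⟩, Algebra.subset_adjoin ⟨q, hq, .inl rfl⟩⟩, rfl⟩

theorem rename_inr_mem_range {q : MvPolynomial (Fin N) ℂ} (hq : q.IsSymmetric) :
    rename Sum.inr q ∈ (algebraMap (symSubalgebra N) (Rzl N)).rangeS :=
  ⟨⟨⟨_, rename_inr_mem_PN hq⟩, Algebra.subset_adjoin ⟨q, hq, .inr rfl⟩⟩, rfl⟩

theorem mem_range_algebraMap_symSubalgebra {x : Rzl N} :
    x ∈ Set.range (algebraMap (symSubalgebra N) (Rzl N)) ↔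
      ∀ e f : Equiv.Perm (Fin N), rename (Sum.map e f) x = x := by
  constructor
  · rintro ⟨⟨y, hy⟩, rfl⟩ e f
    change rename (Sum.map e f) (y : Rzl N) = y
    induction hy using Algebra.adjoin_induction with
    | mem y h =>
      obtain ⟨q, hq, h | h⟩ := h
      · rw [h]
        conv_rhs => rw [← hq e, rename_rename]
        rw [rename_rename]
        rfl
      · rw [h]
        conv_rhs => rw [← hq f, rename_rename]
        rw [rename_rename]
        rfl
    | algebraMap r => exact (rename (Sum.map e f)).commutes r
    | add x y _ _ hx hy => simp [hx, hy]
    | mul x y _ _ hx hy => simp [hx, hy]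
  · intro hx
    let R := (algebraMap (symSubalgebra N) (Rzl N)).rangeS
    have hC (c : ℂ) : (C c : Rzl N) ∈ R := ⟨algebraMap ℂ _ c, rfl⟩
    have hsum (y : Rzl N) :
        ∑ e : Equiv.Perm (Fin N), ∑ f : Equiv.Perm (Fin N), rename (Sum.map e f) y ∈ R := by
      have hy : y ∈ Submodule.span ℂ _ := span_rename_inl_mul_rename_inr.ge Submodule.mem_top
      induction hy using Submodule.span_induction with
      | mem y h =>
        obtain ⟨p, q, rfl⟩ := h
        have : ∑ e : Equiv.Perm (Fin N), ∑ f : Equiv.Perm (Fin N),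
            rename (Sum.map e f) (rename Sum.inl p * rename Sum.inr q) =
            rename Sum.inl (∑ e : Equiv.Perm (Fin N), rename e p) *
              rename Sum.inr (∑ f : Equiv.Perm (Fin N), rename f q) := by
          simp only [map_sum, map_mul, rename_rename, Finset.sum_mul_sum]
          rfl
        rw [this]
        exact mul_mem (rename_inl_mem_range (sum_rename_perm_isSymmetric p))
          (rename_inr_mem_range (sum_rename_perm_isSymmetric q))
      | zero => simp
      | add x y _ _ hx hy =>
        simp only [map_add, Finset.sum_add_distrib]
        exact add_mem hx hy
      | smul a x _ hx =>
        simp only [map_smul, ← Finset.smul_sum]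
        rw [smul_eq_C_mul]
        exact mul_mem (hC a) hx
    have h := mul_mem (hC ((N.factorial : ℂ) * N.factorial)⁻¹) (hsum x)
    have hN : (N.factorial : ℂ) ≠ 0 := by exact_mod_cast N.factorial_ne_zero
    simp only [hx, Finset.sum_const, Finset.card_univ, Fintype.card_perm, Fintype.card_fin] at h
    rw [← smul_eq_C_mul, ← Nat.cast_smul_eq_nsmul ℂ, ← Nat.cast_smul_eq_nsmul ℂ, smul_smul,
      smul_smul, mul_assoc, inv_mul_cancel₀ (mul_ne_zero hN hN), one_smul] at h
    exact h

theorem coeff_prod_X_sub_C_isSymmetric {σ R : Type*} [CommRing R] [Fintype σ] (n : ℕ) :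
    ((∏ i : σ, (Polynomial.X - Polynomial.C (X i : MvPolynomial σ R))).coeff n).IsSymmetric := by
  intro e
  rw [← AlgHom.coe_toRingHom, ← Polynomial.coeff_map, Polynomial.map_prod]
  congr 1
  simpa using Equiv.prod_comp e fun i => Polynomial.X - Polynomial.C (X i : MvPolynomial σ R)

/-- Permutations of the variables act by algebra automorphisms. -/
def renamePermHom (σ : Type*) : Equiv.Perm σ →* (MvPolynomial σ ℂ ≃ₐ[ℂ] MvPolynomial σ ℂ) where
  toFun := renameEquiv ℂ
  map_one' := renameEquiv_refl ℂ
  map_mul' e f := (renameEquiv_trans ℂ f e).symm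

theorem renamePermHom_injective (σ : Type*) : Function.Injective (renamePermHom σ) := by
  intro e f h
  ext i
  have h := DFunLike.congr_fun h (X i)
  simpa [renamePermHom] using h

theorem card_range_renamePermHom_comp {σ G : Type*} [Group G] {φ : G →* Equiv.Perm σ}
    (hφ : Function.Injective φ) : Nat.card ((renamePermHom σ).comp φ).range = Nat.card G :=
  (Nat.card_congr
    (MonoidHom.ofInjective (f := (renamePermHom σ).comp φ)
      ((renamePermHom_injective σ).comp hφ)).toEquiv).symm

theorem card_eq_finrank_of_rename {σ G A : Type*} [Group G] [Finite G] [CommRing A]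
    [Algebra A (MvPolynomial σ ℂ)] [FaithfulSMul A (MvPolynomial σ ℂ)]
    {φ : G →* Equiv.Perm σ} (hφ : Function.Injective φ)
    (h : ∀ x : MvPolynomial σ ℂ, x ∈ Set.range (algebraMap A (MvPolynomial σ ℂ)) ↔
      ∀ g, rename (φ g) x = x) :
    Nat.card G = Module.finrank A (MvPolynomial σ ℂ) := by
  let H := ((renamePermHom σ).comp φ).range
  have : Finite H := inferInstanceAs (Finite (Set.range _))
  have : IsGaloisGroup H A (MvPolynomial σ ℂ) :=
    { faithful := inferInstance
      commutes := ⟨by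
        rintro ⟨_, g, rfl⟩ a x
        change rename (φ g) (a • x) = a • rename (φ g) x
        rw [Algebra.smul_def, Algebra.smul_def, map_mul, (h _).1 ⟨a, rfl⟩ g]⟩
      isInvariant := ⟨fun x hx => (h x).2 fun g => hx ⟨_, g, rfl⟩⟩ }
  rw [← card_range_renamePermHom_comp hφ]
  exact IsGaloisGroup.card_eq_finrank' H A (MvPolynomial σ ℂ)

instance faithfulSMul_PN : FaithfulSMul (PN N) (Rzl N) :=
  (faithfulSMul_iff_algebraMap_injective _ _).2 Subtype.val_injective

variable (N) in
theorem finrank_PN : Module.finrank (PN N) (Rzl N) = N.factorial := by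
  have h := card_eq_finrank_of_rename (G := Equiv.Perm (Fin N)) (A := PN N)
    (φ := (Equiv.Perm.sumCongrHom (Fin N) (Fin N)).comp ((MonoidHom.id _).prod (MonoidHom.id _)))
    (Equiv.Perm.sumCongrHom_injective.comp fun _ _ h => congrArg Prod.fst h)
    fun x => Iff.trans ⟨fun ⟨y, hy⟩ => hy ▸ y.2, fun hx => ⟨⟨x, hx⟩, rfl⟩⟩ mem_PN
  rw [← h]
  simp [Fintype.card_perm]

instance faithfulSMul_symSubalgebra : FaithfulSMul (symSubalgebra N) (Rzl N) :=
  (faithfulSMul_iff_algebraMap_injective _ _).2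
    (Subtype.val_injective.comp Subtype.val_injective)

theorem algebraMap_smul_val {A : Type*} [CommSemiring A] [Algebra A (PN N)] [Algebra A (Rzl N)]
    [IsScalarTower A (PN N) (Rzl N)] (a : A) (x : PN N) :
    ((a • x : PN N) : Rzl N) = a • (x : Rzl N) :=
  map_smul (IsScalarTower.toAlgHom A (PN N) (Rzl N)) a x

variable {A : Type} [CommRing A] [Algebra A (Rzl N)]
  (hA : ∀ x : Rzl N, x ∈ Set.range (algebraMap A (Rzl N)) ↔
    ∀ e f : Equiv.Perm (Fin N), rename (Sum.map e f) x = x)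

include hA

theorem exists_finset_span_of_range_algebraMap [Algebra ℂ A] [IsScalarTower ℂ A (Rzl N)] :
    ∃ s : Finset (Rzl N), s.card ≤ N.factorial * N.factorial ∧
      Submodule.span A (s : Set (Rzl N)) = ⊤ := by
  have key (ι : Fin N → Fin N ⊕ Fin N) (hι : ∀ q : MvPolynomial (Fin N) ℂ, q.IsSymmetric →
      rename ι q ∈ (algebraMap A (Rzl N)).rangeS) :
      ∃ s : Finset (Rzl N), s.card ≤ N.factorial ∧
        Submodule.span A (s : Set (Rzl N)) =
          Subalgebra.toSubmodule (Algebra.adjoin A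
            (Set.range fun i => (X (ι i) : Rzl N))) := by
    have hmap : (∏ i, (Polynomial.X - Polynomial.C (X i : MvPolynomial (Fin N) ℂ))).map
        (rename ι).toRingHom = ∏ i, (Polynomial.X - Polynomial.C (X (ι i) : Rzl N)) := by
      simp [Polynomial.map_prod]
    have hlifts : ∏ i, (Polynomial.X - Polynomial.C (X (ι i) : Rzl N)) ∈
        Polynomial.lifts (algebraMap A (Rzl N)) := by
      rw [Polynomial.lifts_iff_coeff_lifts, ← hmap]
      intro n
      rw [Polynomial.coeff_map]
      exact hι _ (coeff_prod_X_sub_C_isSymmetric n)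
    obtain ⟨f, hf, -, hfm⟩ := Polynomial.lifts_and_natDegree_eq_and_monic hlifts
      (Polynomial.monic_prod_X_sub_C _ _)
    exact exists_finset_span_eq_adjoin_roots N _ _ f hfm hf
  obtain ⟨s, hsc, hs⟩ := key Sum.inl fun q hq => (hA _).2 fun e f => by
    rw [rename_rename]
    exact (rename_rename e Sum.inl q).symm.trans (congrArg _ (hq e))
  obtain ⟨t, htc, ht⟩ := key Sum.inr fun q hq => (hA _).2 fun e f => by
    rw [rename_rename]
    exact (rename_rename f Sum.inr q).symm.trans (congrArg _ (hq f))
  classical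
  open Pointwise in
  refine ⟨s * t, Finset.card_mul_le.trans (Nat.mul_le_mul hsc htc), ?_⟩
  rw [Finset.coe_mul, ← Submodule.span_mul_span, hs, ht, Subalgebra.mul_toSubmodule,
    ← Algebra.adjoin_union, ← Algebra.top_toSubmodule]
  congr 1
  rw [eq_top_iff]
  intro x _
  have hx : x ∈ Algebra.adjoin ℂ (Set.range (X : _ → Rzl N)) := by
    rw [adjoin_range_X]
    trivial
  induction hx using Algebra.adjoin_induction with
  | mem x h =>
    obtain ⟨i | i, rfl⟩ := h
    · exact Algebra.subset_adjoin (.inl ⟨i, rfl⟩)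
    · exact Algebra.subset_adjoin (.inr ⟨i, rfl⟩)
  | algebraMap r =>
    rw [IsScalarTower.algebraMap_apply ℂ A]
    exact Subalgebra.algebraMap_mem _ _
  | add x y _ _ hx hy => exact add_mem (hx trivial) (hy trivial)
  | mul x y _ _ hx hy => exact mul_mem (hx trivial) (hy trivial)

theorem rename_smul_of_range_algebraMap (e f : Equiv.Perm (Fin N)) (a : A) (x : Rzl N) :
    rename (Sum.map e f) (a • x) = a • rename (Sum.map e f) x := by
  rw [Algebra.smul_def, Algebra.smul_def, map_mul,
    (hA _).1 ⟨a, rfl⟩ e f]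

/-- The averaging operator of the diagonal action of the symmetric group. -/
def reynolds : Rzl N →ₗ[A] Rzl N where
  toFun x := C (N.factorial : ℂ)⁻¹ * ∑ e : Equiv.Perm (Fin N), rename (Sum.map e e) x
  map_add' x y := by simp only [map_add, Finset.sum_add_distrib, mul_add]
  map_smul' a x := by
    simp only [rename_smul_of_range_algebraMap hA, ← Finset.smul_sum, RingHom.id_apply,
      mul_smul_comm]

theorem reynolds_apply (x : Rzl N) : reynolds hA x =
    C (N.factorial : ℂ)⁻¹ * ∑ e : Equiv.Perm (Fin N), rename (Sum.map e e) x := rfl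

theorem reynolds_mem (x : Rzl N) : reynolds hA x ∈ PN N := by
  refine mem_PN.2 fun f => ?_
  rw [reynolds_apply, map_mul, rename_C, map_sum]
  congr 1
  refine Fintype.sum_equiv (Equiv.mulLeft f) _ _ fun e => ?_
  rw [rename_rename, Sum.map_comp_map]
  rfl

theorem reynolds_of_mem {x : Rzl N} (hx : x ∈ PN N) : reynolds hA x = x := by
  have hN : (N.factorial : ℂ) ≠ 0 := by exact_mod_cast N.factorial_ne_zero
  simp only [reynolds_apply, mem_PN.1 hx, Finset.sum_const, Finset.card_univ, Fintype.card_perm,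
    Fintype.card_fin]
  rw [← Nat.cast_smul_eq_nsmul ℂ, ← smul_eq_C_mul, smul_smul, inv_mul_cancel₀ hN, one_smul]

theorem reynolds_isHomogeneous (x : Rzl N) (n : ℕ) (hx : x.IsHomogeneous n) :
    (reynolds hA x).IsHomogeneous n := by
  rw [reynolds_apply, ← smul_eq_C_mul]
  exact (homogeneousSubmodule _ ℂ n).smul_mem _ (sum_mem fun _ _ => hx.rename_isHomogeneous)

/-- `PN N` as the range of the averaging operator. -/
def equivRangeReynolds [Algebra A (PN N)] [IsScalarTower A (PN N) (Rzl N)] :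
    PN N ≃ₗ[A] LinearMap.range (reynolds hA) where
  toFun x := ⟨x, x, reynolds_of_mem hA x.2⟩
  invFun y := ⟨y, by obtain ⟨_, x, rfl⟩ := y; exact reynolds_mem hA x⟩
  map_add' _ _ := rfl
  map_smul' a x := Subtype.ext (algebraMap_smul_val a x)
  left_inv _ := rfl
  right_inv _ := rfl

theorem finrank_of_range_algebraMap [FaithfulSMul A (Rzl N)] :
    Module.finrank A (Rzl N) = N.factorial * N.factorial := by
  have h := card_eq_finrank_of_rename (A := A) (φ := Equiv.Perm.sumCongrHom (Fin N) (Fin N))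
    Equiv.Perm.sumCongrHom_injective fun x =>
      (hA x).trans ⟨fun h g => h g.1 g.2, fun h e f => h (e, f)⟩
  rw [← h]
  simp [Fintype.card_perm]

theorem free_and_rank_PN [Algebra ℂ A] [IsScalarTower ℂ A (Rzl N)] [FaithfulSMul A (Rzl N)]
    [Algebra A (PN N)] [IsScalarTower A (PN N) (Rzl N)] :
    Module.Free A (PN N) ∧ Module.rank A (PN N) = N.factorial := by
  obtain ⟨s, hsc, hs⟩ := exists_finset_span_of_range_algebraMap hA
  have hcomp (a : A) (n : ℕ) : homogeneousComponent n (algebraMap A (Rzl N) a) ∈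
      Set.range (algebraMap A (Rzl N)) := by
    refine (hA _).2 fun e f => ?_
    rw [rename_homogeneousComponent, (hA _).1 ⟨a, rfl⟩ e f]
  have : Module.Free A (LinearMap.range (reynolds hA)) :=
    free_range_of_isHomogeneous hcomp hs (hsc.trans (finrank_of_range_algebraMap hA).ge)
      (reynolds hA) (fun x => reynolds_of_mem hA (reynolds_mem hA x)) (reynolds_isHomogeneous hA)
  have hfree : Module.Free A (PN N) := .of_equiv (equivRangeReynolds hA).symm
  have : Module.Finite A (Rzl N) := ⟨⟨s, hs⟩⟩
  have : Module.Finite A (PN N) := Module.Finite.equiv (equivRangeReynolds hA).symm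
  have : IsDomain A := IsDomain.of_faithfulSMul A (Rzl N)
  refine ⟨hfree, ?_⟩
  have h := Module.finrank_mul_finrank' (R := A) (S := PN N) (Rzl N)
  rw [finrank_PN, finrank_of_range_algebraMap hA] at h
  rw [← Nat.eq_of_mul_eq_mul_right N.factorial_pos h, Module.finrank_eq_rank]

end

set_option synthInstance.maxHeartbeats 1000000 in
theorem stmt0 (N : ℕ) (hN : 0 < N) :
    Module.Free (Algebra.adjoin ℂ (symGens N)) (PN N) ∧
    Module.rank (Algebra.adjoin ℂ (symGens N)) (PN N) = Nat.factorial N := by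
  have : IsScalarTower ℂ (symSubalgebra N) (Rzl N) := .of_algebraMap_eq fun _ => rfl
  have : IsScalarTower (symSubalgebra N) (PN N) (Rzl N) := .of_algebraMap_eq fun _ => rfl
  have h := free_and_rank_PN (A := symSubalgebra N) (N := N)
    fun x => mem_range_algebraMap_symSubalgebra
  exact h
end
end

section
/- Define p_ij ∈ P_N (0 ≤ i,j ≤ N) by the identity Π_{i=1}^N ((u − z_i)(v − λ_i) − 1) = Σ_{i,j=0}^N p_ij u^{N−i} v^{N−j} in C[z,λ][u,v]. Then the elements p_ij, 0 ≤ i,j ≤ N, generate P_N as a C-algebra. -/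
open MvPolynomial

noncomputable section

/-- The universal multi-symmetric polynomial
`Π_{i=1}^N ((u − z_i)(v − λ_i) − 1)` as an element of `ℂ[z,λ][v][u]`
(outer variable `u`, inner variable `v`). -/
def univMultiSym (N : ℕ) : Polynomial (Polynomial (Rzl N)) :=
  ∏ i : Fin N,
    ((Polynomial.X - Polynomial.C (Polynomial.C (X (Sum.inl i)))) *
        (Polynomial.C Polynomial.X - Polynomial.C (Polynomial.C (X (Sum.inr i)))) - 1)

/-- `p_{ij}`: the coefficient of `u^{N-i} v^{N-j}` in the universal
multi-symmetric polynomial. -/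
def pCoeff (N : ℕ) (i j : Fin (N + 1)) : Rzl N :=
  ((univMultiSym N).coeff (N - (i : ℕ))).coeff (N - (j : ℕ))

theorem sum_injective_prod_mem {κ R : Type*} [Fintype κ] [DecidableEq κ] [CommRing R]
    (A : Subring R) (M : Submonoid (κ → R)) (hM : ∀ f ∈ M, ∑ i, f i ∈ A) (k : ℕ)
    (F : Fin k → κ → R) (hF : ∀ j, F j ∈ M) :
    ∑ e : Fin k → κ with Function.Injective e, ∏ j, F j (e j) ∈ A := by
  classical
  induction k with
  | zero =>
    refine A.sum_mem fun e _ => ?_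
    simp
  | succ k ih =>
    have key : ∑ e : Fin (k + 1) → κ with Function.Injective e, ∏ j, F j (e j) =
        (∑ i, F 0 i) * (∑ e : Fin k → κ with Function.Injective e, ∏ j, F j.succ (e j)) -
        ∑ l : Fin k, ∑ e : Fin k → κ with Function.Injective e,
          ∏ j, Function.update (fun j => F j.succ) l (F 0 * F l.succ) j (e j) := by
      rw [Finset.sum_comm, Finset.mul_sum, ← Finset.sum_sub_distrib]
      simp only [Finset.sum_filter]
      rw [← Equiv.sum_comp (Fin.consEquiv fun _ => κ), Fintype.sum_prod_type, Finset.sum_comm]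
      refine Finset.sum_congr rfl fun e _ => ?_
      simp only [Fin.consEquiv, Equiv.coe_fn_mk, Fin.cons_injective_iff, Fin.prod_univ_succ,
        Fin.cons_zero, Fin.cons_succ]
      by_cases he : Function.Injective e
      · have h1 : ∀ l : Fin k, ∏ j, Function.update (fun j => F j.succ) l (F 0 * F l.succ) j (e j) =
            F 0 (e l) * ∏ j, F j.succ (e j) := by
          intro l
          rw [← Finset.mul_prod_erase _ _ (Finset.mem_univ l),
            ← Finset.mul_prod_erase _ (fun j => F j.succ (e j)) (Finset.mem_univ l)]
          rw [Function.update_self, Pi.mul_apply, mul_assoc]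
          congr 2
          refine Finset.prod_congr rfl fun j hj => ?_
          rw [Function.update_of_ne (Finset.ne_of_mem_erase hj)]
        simp only [he, and_true, if_true, h1, ← Finset.sum_mul]
        rw [← sub_mul, ← Finset.sum_image (s := Finset.univ) (g := e) (f := F 0) he.injOn,
          ← Finset.sum_filter, ← Finset.sum_mul]
        congr 1
        rw [eq_sub_iff_add_eq, add_comm, ← Finset.sum_filter_add_sum_filter_not Finset.univ
          (fun i => i ∈ Set.range e)]
        congr 1
        refine Finset.sum_congr ?_ fun _ _ => rfl
        ext; simp
      · simp [he]
    rw [key]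
    refine A.sub_mem (A.mul_mem (hM _ (hF 0)) (ih _ fun j => hF _)) (A.sum_mem fun l _ => ih _ ?_)
    intro j
    rcases eq_or_ne j l with rfl | h
    · simpa using M.mul_mem (hF 0) (hF _)
    · simpa [h] using hF _

theorem sum_perm_prod_mem {R : Type*} [CommRing R] {N : ℕ}
    (A : Subring R) (M : Submonoid (Fin N → R)) (hM : ∀ f ∈ M, ∑ i, f i ∈ A)
    (F : Fin N → Fin N → R) (hF : ∀ j, F j ∈ M) :
    ∑ σ : Equiv.Perm (Fin N), ∏ j, F j (σ j) ∈ A := by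
  convert sum_injective_prod_mem A M hM N F hF using 1
  refine Finset.sum_bij (fun σ _ => ⇑σ) (fun σ _ => by simp [σ.injective])
    (fun σ _ τ _ h => DFunLike.coe_injective h) (fun e he => ?_) (fun _ _ => rfl)
  exact ⟨Equiv.ofBijective e (Finite.injective_iff_bijective.1 (Finset.mem_filter.1 he).2),
    Finset.mem_univ _, rfl⟩

/-- The subring of power series with coefficients in a given subring. -/
def Subring.powerSeries {R : Type*} [CommRing R] (A : Subring R) : Subring (PowerSeries R) :=
  (PowerSeries.map A.subtype).range

theorem Subring.mem_powerSeries {R : Type*} [CommRing R] {A : Subring R} {f : PowerSeries R} :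
    f ∈ A.powerSeries ↔ ∀ n, PowerSeries.coeff n f ∈ A := by
  constructor
  · rintro ⟨g, rfl⟩ n
    rw [PowerSeries.coeff_map]
    exact (PowerSeries.coeff n g).2
  · intro h
    refine ⟨PowerSeries.mk fun n => ⟨_, h n⟩, ?_⟩
    ext n
    rw [PowerSeries.coeff_map, PowerSeries.coeff_mk, Subring.subtype_apply]

theorem Subring.mem_powerSeries_of_mul_eq_one {R : Type*} [CommRing R] {A : Subring R}
    {f g : PowerSeries R} (hf : f ∈ A.powerSeries) (h0 : PowerSeries.constantCoeff f = 1)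
    (hfg : f * g = 1) : g ∈ A.powerSeries := by
  obtain ⟨f', rfl⟩ := hf
  have hu : IsUnit f' := by
    rw [PowerSeries.isUnit_iff_constantCoeff]
    have : PowerSeries.constantCoeff f' = 1 := by
      apply Subtype.ext
      rw [← PowerSeries.coeff_zero_eq_constantCoeff_apply, PowerSeries.coeff_map] at h0
      rw [← PowerSeries.coeff_zero_eq_constantCoeff_apply]
      exact h0
    rw [this]
    exact isUnit_one
  obtain ⟨g', hg'⟩ := hu.exists_right_inv
  refine ⟨g', ?_⟩
  have h2 := congrArg (PowerSeries.map A.subtype) hg'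
  rw [map_mul, map_one] at h2
  exact (left_inv_eq_right_inv (by rw [mul_comm]; exact hfg) h2).symm

theorem sum_pow_mem_of_esymm_mem {κ R : Type*} [Fintype κ] [CommRing R] (B : Subring R)
    (w : κ → R) (h : ∀ i, ∑ S ∈ Finset.univ.powersetCard i, ∏ k ∈ S, w k ∈ B) (n : ℕ) : ∑ i, w i ^ n ∈ B := by
  classical
  obtain ⟨q, hq⟩ := esymmAlgHom_surjective (σ := κ) ℤ (n := Fintype.card κ) le_rfl
    ⟨psum κ ℤ n, fun e => rename_psum κ ℤ n e⟩
  have h1 : ∑ i, w i ^ n = aeval w (psum κ ℤ n) := by simp [psum]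
  have h2 : psum κ ℤ n = aeval (fun i : Fin (Fintype.card κ) => esymm κ ℤ (i + 1)) q := by
    rw [← esymmAlgHom_apply, hq]
  rw [h1, h2]
  clear h1 h2 hq
  induction q using MvPolynomial.induction_on with
  | C a => simp
  | add p q hp hq => simpa using B.add_mem hp hq
  | mul_X p i hp =>
    have hi : aeval w (esymm κ ℤ (i + 1)) ∈ B := by simpa [esymm, map_prod] using h (i + 1)
    simpa using B.mul_mem hp hi

/-- The power series `1 / (1 - a X)`. -/
def geomSeries {R : Type*} [CommRing R] (a : R) : PowerSeries R :=
  PowerSeries.rescale a (PowerSeries.mk 1)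

theorem one_sub_mul_geomSeries {R : Type*} [CommRing R] (a : R) :
    (1 - PowerSeries.C a * PowerSeries.X) * geomSeries a = 1 := by
  have := congrArg (PowerSeries.rescale a) (PowerSeries.mk_one_mul_one_sub_eq_one R)
  rw [map_mul, map_sub, map_one, PowerSeries.rescale_X] at this
  rw [mul_comm]
  exact this

theorem coeff_geomSeries_pow {R : Type*} [CommRing R] (a : R) (d n : ℕ) :
    PowerSeries.coeff n (geomSeries a ^ (d + 1)) = (d + n).choose d * a ^ n := by
  rw [geomSeries, ← map_pow, PowerSeries.mk_one_pow_eq_mk_choose_add, PowerSeries.coeff_rescale,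
    PowerSeries.coeff_mk, mul_comm]

theorem coeff_C_add_X_mul_geomSeries_pow {R : Type*} [CommRing R] (x y : R) (a b : ℕ) :
    PowerSeries.coeff (b + 1)
      ((PowerSeries.C x + PowerSeries.X * geomSeries y) ^ (a + 1)) =
    (a + 1) * (x ^ a * y ^ b) + ∑ m ∈ Finset.range a,
      if m + 1 ≤ b then
        ((a + 1).choose (m + 2) * b.choose (m + 1) : ℕ) * (x ^ (a - (m + 1)) * y ^ (b - (m + 1)))
      else 0 := by
  have hterm : ∀ k, PowerSeries.coeff (b + 1) ((PowerSeries.X * geomSeries y) ^ (k + 1) *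
      PowerSeries.C x ^ (a - k) * ((a + 1).choose (k + 1) : PowerSeries R)) =
      if k ≤ b then ((a + 1).choose (k + 1) * b.choose k : ℕ) * (x ^ (a - k) * y ^ (b - k))
      else 0 := by
    intro k
    rw [mul_pow, mul_assoc, mul_assoc, PowerSeries.coeff_X_pow_mul']
    simp only [add_le_add_iff_right, Nat.add_sub_add_right]
    split_ifs with h
    · rw [← map_pow, ← map_natCast (PowerSeries.C (R := R)), ← map_mul, PowerSeries.coeff_mul_C,
        coeff_geomSeries_pow, Nat.add_sub_cancel' h]
      push_cast
      ring
    · rfl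
  rw [add_comm (PowerSeries.C x), add_pow, map_sum, Finset.sum_range_succ']
  have h0 : PowerSeries.coeff (b + 1) ((PowerSeries.X * geomSeries y) ^ 0 *
      PowerSeries.C x ^ (a + 1 - 0) * ((a + 1).choose 0 : PowerSeries R)) = 0 := by
    rw [← map_pow, pow_zero, one_mul, Nat.choose_zero_right, Nat.cast_one, mul_one,
      PowerSeries.coeff_C, if_neg b.succ_ne_zero]
  rw [h0, add_zero]
  simp only [Nat.add_sub_add_right, hterm]
  rw [Finset.sum_range_succ']
  simp [add_comm, add_left_comm, one_add_one_eq_two]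

theorem sum_pow_mul_pow_mem {κ R : Type*} [Fintype κ] [CommRing R]
    (A : Subring R) (hA : ∀ (n : ℕ) (r : R), ((n + 1 : ℕ) : R) * r ∈ A → r ∈ A) (x y : κ → R)
    (h : ∀ n, ∑ i, (PowerSeries.C (x i) + PowerSeries.X * geomSeries (y i)) ^ n ∈
      A.powerSeries) (a b : ℕ) : ∑ i, x i ^ a * y i ^ b ∈ A := by
  induction a using Nat.strong_induction_on generalizing b with
  | _ a ih =>
    have h1 := Subring.mem_powerSeries.1 (h (a + 1)) (b + 1)
    simp only [map_sum, coeff_C_add_X_mul_geomSeries_pow, Finset.sum_add_distrib] at h1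
    apply hA a
    rw [Finset.mul_sum]
    push_cast
    refine (A.add_mem_cancel_right (y := _) ?_).1 h1
    rw [Finset.sum_comm]
    refine A.sum_mem fun m hm => ?_
    split_ifs
    · rw [← Finset.mul_sum]
      exact A.mul_mem (natCast_mem A _)
        (ih _ (by have := Finset.mem_range.1 hm; omega) _)
    · simp

open Polynomial in
theorem Polynomial.reflect_prod {ι R : Type*} [CommSemiring R] (s : Finset ι) (f : ι → R[X])
    (hf : ∀ i, (f i).natDegree ≤ 1) :
    reflect s.card (∏ i ∈ s, f i) = ∏ i ∈ s, reflect 1 (f i) := by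
  classical
  induction s using Finset.induction_on with
  | empty => simp
  | insert a s ha ih =>
    rw [Finset.prod_insert ha, Finset.prod_insert ha, Finset.card_insert_of_notMem ha, add_comm,
      reflect_mul _ _ (hf a), ih]
    refine (natDegree_prod_le _ _).trans ?_
    simpa using Finset.sum_le_card_nsmul s _ 1 fun i _ => hf i

section Coefficients

open Polynomial

variable {R : Type*} [CommRing R] {N : ℕ} (z l : Fin N → R)

theorem coeff_prod_eq_sum_powersetCard {i : ℕ} (hi : i ≤ N) :
    (∏ k, ((Polynomial.X - Polynomial.C (Polynomial.C (z k))) * (Polynomial.C Polynomial.X - Polynomial.C (Polynomial.C (l k))) - 1 : R[X][X])).coeff (N - i) =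
      ∑ S ∈ Finset.univ.powersetCard i,
        ∏ k, if k ∈ S then -(Polynomial.C (z k) * (Polynomial.X - Polynomial.C (l k)) + 1) else Polynomial.X - Polynomial.C (l k) := by
  have hfac : ∀ k, ((Polynomial.X - Polynomial.C (Polynomial.C (z k))) * (Polynomial.C Polynomial.X - Polynomial.C (Polynomial.C (l k))) - 1 : R[X][X]) =
      Polynomial.C (-(Polynomial.C (z k) * (Polynomial.X - Polynomial.C (l k)) + 1)) + Polynomial.C (Polynomial.X - Polynomial.C (l k)) * Polynomial.X := by
    intro k
    simp only [map_neg, map_add, map_mul, map_sub, map_one]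
    ring
  simp only [hfac, Finset.prod_add, finsetSum_coeff]
  have hS : ∀ S : Finset (Fin N), ((∏ k ∈ S, Polynomial.C (-(Polynomial.C (z k) * (Polynomial.X - Polynomial.C (l k)) + 1))) *
      ∏ k ∈ Finset.univ \ S, (Polynomial.C (Polynomial.X - Polynomial.C (l k)) * Polynomial.X) : R[X][X]).coeff (N - i) =
      if S.card = i then
        ∏ k, if k ∈ S then -(Polynomial.C (z k) * (Polynomial.X - Polynomial.C (l k)) + 1) else Polynomial.X - Polynomial.C (l k) else 0 := by
    intro S
    have hc : (Finset.univ \ S).card = N - S.card := by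
      rw [Finset.card_sdiff_of_subset (Finset.subset_univ S), Finset.card_fin]
    have hle : S.card ≤ N := by simpa using S.card_le_univ
    rw [Finset.prod_mul_distrib, Finset.prod_const, ← map_prod, ← map_prod, ← mul_assoc, ← map_mul,
      coeff_C_mul_X_pow, hc, Finset.prod_ite, Finset.filter_mem_eq_inter, Finset.univ_inter,
      ← Finset.sdiff_eq_filter]
    exact if_congr (by omega) rfl rfl
  simp only [hS]
  rw [← Finset.sum_filter, Finset.powersetCard_eq_filter]

theorem natDegree_ite_le (S : Finset (Fin N)) (k : Fin N) :
    (if k ∈ S then -(Polynomial.C (z k) * (Polynomial.X - Polynomial.C (l k)) + 1) else Polynomial.X - Polynomial.C (l k) : R[X]).natDegree ≤ 1 := by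
  split_ifs <;> compute_degree

theorem natDegree_coeff_prod_le {i : ℕ} (hi : i ≤ N) :
    ((∏ k, ((Polynomial.X - Polynomial.C (Polynomial.C (z k))) * (Polynomial.C Polynomial.X - Polynomial.C (Polynomial.C (l k))) - 1 : R[X][X])).coeff (N - i)).natDegree
      ≤ N := by
  rw [coeff_prod_eq_sum_powersetCard z l hi]
  refine natDegree_sum_le_of_forall_le _ _ fun S _ => (natDegree_prod_le _ _).trans ?_
  simpa using Finset.sum_le_card_nsmul Finset.univ _ 1 fun k _ => natDegree_ite_le z l S k

theorem reflect_coeff_prod {i : ℕ} (hi : i ≤ N) :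
    (((∏ k, ((Polynomial.X - Polynomial.C (Polynomial.C (z k))) * (Polynomial.C Polynomial.X - Polynomial.C (Polynomial.C (l k))) - 1 : R[X][X])).coeff (N - i)).reflect N :
      PowerSeries R) =
    (∏ k, (1 - PowerSeries.C (l k) * PowerSeries.X)) *
      ((-1) ^ i * ∑ S ∈ Finset.univ.powersetCard i,
        ∏ k ∈ S, (PowerSeries.C (z k) + PowerSeries.X * geomSeries (l k))) := by
  rw [coeff_prod_eq_sum_powersetCard z l hi]
  have hadd : ∀ (T : Finset (Finset (Fin N))) (f : Finset (Fin N) → R[X]),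
      reflect N (∑ S ∈ T, f S) = ∑ S ∈ T, reflect N (f S) := fun T f =>
    map_sum (AddMonoidHom.mk' (reflect N) fun f g => reflect_add f g N) f T
  rw [hadd, ← coeToPowerSeries.ringHom_apply, map_sum,
    Finset.mul_sum, Finset.mul_sum]
  refine Finset.sum_congr rfl fun S hS => ?_
  have hr := Polynomial.reflect_prod Finset.univ _ (natDegree_ite_le z l S)
  rw [Finset.card_fin] at hr
  rw [hr, map_prod]
  have hk : ∀ k, coeToPowerSeries.ringHom
      (reflect 1 (if k ∈ S then -(Polynomial.C (z k) * (Polynomial.X - Polynomial.C (l k)) + 1) else Polynomial.X - Polynomial.C (l k))) =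
      (1 - PowerSeries.C (l k) * PowerSeries.X) *
      if k ∈ S then -(PowerSeries.C (z k) + PowerSeries.X * geomSeries (l k)) else 1 := by
    intro k
    have hX : reflect 1 (Polynomial.X - Polynomial.C (l k)) = 1 - Polynomial.C (l k) * Polynomial.X := by
      rw [sub_eq_add_neg, ← map_neg, reflect_add, reflect_one_X, reflect_C, map_neg, pow_one]
      ring
    have hW : reflect 1 (-(Polynomial.C (z k) * (Polynomial.X - Polynomial.C (l k)) + 1)) = -(Polynomial.C (z k) * (1 - Polynomial.C (l k) * Polynomial.X) + Polynomial.X) := by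
      rw [← neg_one_mul, ← map_one Polynomial.C, ← map_neg, reflect_C_mul, reflect_add, reflect_C_mul, hX,
        map_one, reflect_one, pow_one, map_neg, map_one, neg_one_mul]
    have hg := one_sub_mul_geomSeries (l k)
    split_ifs
    · rw [hW]
      simp only [map_neg, map_add, map_mul, map_sub, map_one, coeToPowerSeries.ringHom_apply,
        Polynomial.coe_C, Polynomial.coe_X]
      linear_combination (PowerSeries.X : PowerSeries R) * hg
    · rw [hX]
      simp
  simp only [hk, Finset.prod_mul_distrib, Finset.prod_ite_mem, Finset.univ_inter]
  rw [Finset.prod_neg, (Finset.mem_powersetCard.1 hS).2]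

theorem sum_pow_mem_powerSeries (A : Subring R)
    (h : ∀ i ≤ N, ∀ j ≤ N, ((∏ k, ((Polynomial.X - Polynomial.C (Polynomial.C (z k))) * (Polynomial.C Polynomial.X - Polynomial.C (Polynomial.C (l k))) - 1 :
      R[X][X])).coeff (N - i)).coeff (N - j) ∈ A) (n : ℕ) :
    ∑ k, (PowerSeries.C (z k) + PowerSeries.X * geomSeries (l k)) ^ n ∈ A.powerSeries := by
  have hD : ∀ i ≤ N, (∏ k, (1 - PowerSeries.C (l k) * PowerSeries.X)) *
      ((-1) ^ i * ∑ S ∈ Finset.univ.powersetCard i,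
        ∏ k ∈ S, (PowerSeries.C (z k) + PowerSeries.X * geomSeries (l k))) ∈ A.powerSeries := by
    intro i hi
    rw [← reflect_coeff_prod z l hi, Subring.mem_powerSeries]
    intro j
    rw [Polynomial.coeff_coe, coeff_reflect]
    rcases le_or_gt j N with hj | hj
    · rw [revAt_le hj]
      exact h i hi j hj
    · rw [revAt_eq_self_of_lt hj,
        coeff_eq_zero_of_natDegree_lt ((natDegree_coeff_prod_le z l hi).trans_lt hj)]
      exact A.zero_mem
  have hmul : (∏ k, (1 - PowerSeries.C (l k) * PowerSeries.X)) * ∏ k, geomSeries (l k) = 1 := by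
    rw [← Finset.prod_mul_distrib]
    exact Finset.prod_eq_one fun k _ => one_sub_mul_geomSeries (l k)
  have hinv : ∏ k, geomSeries (l k) ∈ A.powerSeries := by
    refine Subring.mem_powerSeries_of_mul_eq_one ?_ ?_ hmul
    · simpa using hD 0 (Nat.zero_le _)
    · simp [map_prod]
  refine sum_pow_mem_of_esymm_mem _ _ (fun i => ?_) n
  rcases le_or_gt i N with hi | hi
  · have := mul_mem (mul_mem hinv (hD i hi)) (pow_mem (neg_mem (one_mem A.powerSeries)) i)
    convert this using 1
    have hs : ((-1) ^ i * (-1) ^ i : PowerSeries R) = 1 := by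
      rw [← mul_pow]; simp
    rw [← mul_assoc, mul_comm (∏ k, geomSeries (l k)), hmul, one_mul, mul_right_comm, hs, one_mul]
  · rw [Finset.powersetCard_eq_empty.2 (by simpa using hi)]
    simp

end Coefficients

theorem permHat_monomial {N : ℕ} (σ : Equiv.Perm (Fin N)) (m : Fin N ⊕ Fin N →₀ ℕ) (c : ℂ) :
    permHat N σ (monomial m c) =
      C c * ∏ j, (X (Sum.inl (σ j)) ^ m (Sum.inl j) * X (Sum.inr (σ j)) ^ m (Sum.inr j)) := by
  rw [monomial_eq, Finsupp.prod_fintype _ _ (by simp), Fintype.prod_sum_type,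
    ← Finset.prod_mul_distrib]
  simp [permHat, map_prod]

theorem mem_PN_s2 {N : ℕ} {p : Rzl N} : p ∈ PN N ↔ ∀ σ, permHat N σ p = p := by
  simp [PN, Algebra.mem_iInf, AlgHom.mem_equalizer]

theorem pCoeff_mem_PN (N : ℕ) (i j : Fin (N + 1)) : pCoeff N i j ∈ PN N := by
  rw [mem_PN_s2]
  intro σ
  have h : (univMultiSym N).map (Polynomial.mapRingHom (permHat N σ : Rzl N →+* Rzl N)) =
      univMultiSym N := by
    rw [univMultiSym, Polynomial.map_prod]
    refine Fintype.prod_equiv σ _ _ fun k => ?_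
    simp [permHat]
  conv_rhs => rw [pCoeff, ← h]
  simp [pCoeff]

theorem PN_le_of_sum_mem {N : ℕ} (A : Subalgebra ℂ (Rzl N))
    (h : ∀ a b : ℕ, ∑ k, (X (Sum.inl k) : Rzl N) ^ a * X (Sum.inr k) ^ b ∈ A) : PN N ≤ A := by
  intro p hp
  rw [mem_PN_s2] at hp
  have hsum : ∀ q : Rzl N, ∑ σ, permHat N σ q ∈ A := by
    intro q
    induction q using MvPolynomial.induction_on' with
    | add p q hp hq =>
      simp only [map_add, Finset.sum_add_distrib]
      exact A.add_mem hp hq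
    | monomial m c =>
      simp only [permHat_monomial, ← Finset.mul_sum]
      refine A.mul_mem (A.algebraMap_mem c) ?_
      let M : Submonoid (Fin N → Rzl N) :=
        { carrier := {f | ∃ a b : ℕ, f = fun k => X (Sum.inl k) ^ a * X (Sum.inr k) ^ b}
          one_mem' := ⟨0, 0, by ext1; simp⟩
          mul_mem' := by
            rintro _ _ ⟨a, b, rfl⟩ ⟨c, d, rfl⟩
            exact ⟨a + c, b + d, by ext1; simp only [Pi.mul_apply]; ring⟩ }
      refine sum_perm_prod_mem A.toSubring M ?_
        (fun j k => X (Sum.inl k) ^ m (Sum.inl j) * X (Sum.inr k) ^ m (Sum.inr j))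
        fun j => ⟨_, _, rfl⟩
      rintro _ ⟨a, b, rfl⟩
      exact h a b
  have hN := hsum p
  simp only [hp, Finset.sum_const, Finset.card_univ, Fintype.card_perm, Fintype.card_fin] at hN
  have := A.smul_mem hN ((N.factorial : ℂ)⁻¹)
  rwa [← Nat.cast_smul_eq_nsmul ℂ, inv_smul_smul₀ (by exact_mod_cast N.factorial_ne_zero)] at this

set_option synthInstance.maxHeartbeats 1000000 in
theorem stmt2 (N : ℕ) (hN : 0 < N) :
    Algebra.adjoin ℂ {x : Rzl N | ∃ i j : Fin (N + 1), x = pCoeff N i j} = PN N := by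
  refine le_antisymm (Algebra.adjoin_le ?_) (PN_le_of_sum_mem _ fun a b => ?_)
  · rintro _ ⟨i, j, rfl⟩
    exact pCoeff_mem_PN N i j
  · set A := Algebra.adjoin ℂ {x : Rzl N | ∃ i j : Fin (N + 1), x = pCoeff N i j}
    refine sum_pow_mul_pow_mem A.toSubring (fun n r hr => ?_) _ _
      (sum_pow_mem_powerSeries _ _ A.toSubring fun i hi j hj => ?_) a b
    · have := A.smul_mem hr (((n + 1 : ℕ) : ℂ)⁻¹)
      rwa [← nsmul_eq_mul, ← Nat.cast_smul_eq_nsmul ℂ,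
        inv_smul_smul₀ (by exact_mod_cast n.succ_ne_zero)] at this
    · exact Algebra.subset_adjoin
        ⟨⟨i, Nat.lt_succ_of_le hi⟩, ⟨j, Nat.lt_succ_of_le hj⟩, rfl⟩
end
end

section
/- For all u, v ∈ C, the operator P(u,v) commutes with multiplication by λ_i for every i, with K_i for every i, and with σ̂ for every σ ∈ S_N; equivalently, all the coefficients c_ij of the universal central polynomial lie in the center of H. -/
open MvPolynomial

noncomputable section

/-- The automorphism `σ̂` as an endomorphism of `ℂ[z,λ]`. -/
def permOp (N : ℕ) (σ : Equiv.Perm (Fin N)) : Module.End ℂ (Rzl N) :=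
  (permHat N σ).toLinearMap

/-- The automorphism `s_ij^z` exchanging `z_i ↔ z_j` only. -/
def sZ (N : ℕ) (i j : Fin N) : Rzl N ≃ₐ[ℂ] Rzl N :=
  renameEquiv ℂ (Equiv.sumCongr (Equiv.swap i j) (Equiv.refl (Fin N)))

/-- The automorphism `s_ij^λ` exchanging `λ_i ↔ λ_j` only. -/
def sL (N : ℕ) (i j : Fin N) : Rzl N ≃ₐ[ℂ] Rzl N :=
  renameEquiv ℂ (Equiv.sumCongr (Equiv.refl (Fin N)) (Equiv.swap i j))

/-- Multiplication by a polynomial, as an endomorphism of `ℂ[z,λ]`. -/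
def mulP (N : ℕ) (p : Rzl N) : Module.End ℂ (Rzl N) := LinearMap.mulLeft ℂ p

/-- Product of the endomorphisms `f i`, `i ∈ T`, taken in increasing order of `i`
(the order is irrelevant when the factors pairwise commute). -/
def ordProd {N : ℕ} (T : Finset (Fin N)) (f : Fin N → Module.End ℂ (Rzl N)) :
    Module.End ℂ (Rzl N) :=
  ((T.sort (· ≤ ·)).map f).prod

/-- The universal central polynomial evaluated at `(u,v)`:
`P(u,v) = (−1)^N Σ_σ sgn(σ) (Σ_{T ⊆ Fix σ} (−1)^{|T|} (Π_{i∈T}(v−λ_i))·(Π_{i∈T}(u−K_i))) ∘ σ̂`. -/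
def Puv {N : ℕ} (K : Fin N → Module.End ℂ (Rzl N)) (u v : ℂ) : Module.End ℂ (Rzl N) :=
  ((-1 : ℤ) ^ N) • ∑ σ : Equiv.Perm (Fin N), (Equiv.Perm.sign σ : ℤ) •
    ((∑ T ∈ (Finset.univ.filter fun i => σ i = i).powerset,
        ((-1 : ℤ) ^ T.card) •
          (mulP N (∏ i ∈ T, ((C v : Rzl N) - X (Sum.inr i))) *
            ordProd T (fun i => u • (1 : Module.End ℂ (Rzl N)) - K i))) * permOp N σ)

/-- The relations of the rational Cherednik algebra of `S_n` at `t = 0`, together with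
partial products `pa T`, `pb T` of the two commuting families over finite sets. -/
structure CherednikRel {n : ℕ} {A : Type*} [Ring A] (a b : Fin n → A)
    (pa pb : Finset (Fin n) → A) (s : Equiv.Perm (Fin n) → A) : Prop where
  s_one : s 1 = 1
  s_mul : ∀ σ τ, s (σ * τ) = s σ * s τ
  s_a : ∀ σ i, s σ * a i = a (σ i) * s σ
  s_b : ∀ σ i, s σ * b i = b (σ i) * s σ
  comm_a : ∀ i j, a i * a j = a j * a i
  comm_b : ∀ i j, b i * b j = b j * b i
  b_a_ne : ∀ i j, i ≠ j → b i * a j = a j * b i - s (Equiv.swap i j)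
  b_a_self : ∀ i, b i * a i = a i * b i + ∑ j ∈ Finset.univ.erase i, s (Equiv.swap i j)
  pa_empty : pa ∅ = 1
  pb_empty : pb ∅ = 1
  pa_insert : ∀ i T, i ∉ T → pa (insert i T) = a i * pa T
  pb_insert : ∀ i T, i ∉ T → pb (insert i T) = b i * pb T

namespace CherednikRel

variable {n : ℕ} {A : Type*} [Ring A] {a b : Fin n → A}
  {pa pb : Finset (Fin n) → A} {s : Equiv.Perm (Fin n) → A}

/-- Index set of pairs `(T, σ)` with `T` fixed pointwise by `σ`. -/
def fixedPairs (n : ℕ) : Finset (Finset (Fin n) × Equiv.Perm (Fin n)) :=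
  Finset.univ.filter fun x => ∀ i ∈ x.1, x.2 i = i

/-- The sign attached to a pair `(T, σ)`. -/
def pairSign {n : ℕ} (x : Finset (Fin n) × Equiv.Perm (Fin n)) : ℤ :=
  (Equiv.Perm.sign x.2 : ℤ) * (-1) ^ x.1.card

/-- The signed sum of `pa T * pb T * s σ` over the pairs `(T, σ)` with `T ⊆ Fix σ`. -/
def centralSum (pa pb : Finset (Fin n) → A) (s : Equiv.Perm (Fin n) → A) : A :=
  ∑ x ∈ fixedPairs n, pairSign x • (pa x.1 * pb x.1 * s x.2)

theorem commute_a (h : CherednikRel a b pa pb s) (i : Fin n) (T : Finset (Fin n)) :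
    a i * pa T = pa T * a i := by
  induction T using Finset.induction_on with
  | empty => simp [h.pa_empty]
  | insert j T hj ih => rw [h.pa_insert j T hj, ← mul_assoc, h.comm_a, mul_assoc, ih, mul_assoc]

theorem commute_b (h : CherednikRel a b pa pb s) (i : Fin n) (T : Finset (Fin n)) :
    b i * pb T = pb T * b i := by
  induction T using Finset.induction_on with
  | empty => simp [h.pb_empty]
  | insert j T hj ih => rw [h.pb_insert j T hj, ← mul_assoc, h.comm_b, mul_assoc, ih, mul_assoc]

theorem s_pa (h : CherednikRel a b pa pb s) (σ : Equiv.Perm (Fin n)) (T : Finset (Fin n)) :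
    s σ * pa T = pa (T.map σ.toEmbedding) * s σ := by
  induction T using Finset.induction_on with
  | empty => simp [h.pa_empty]
  | insert j T hj ih =>
    rw [h.pa_insert j T hj, Finset.map_insert, h.pa_insert _ _ (by simpa using hj),
      ← mul_assoc, h.s_a, mul_assoc, ih, mul_assoc]
    rfl

theorem s_pb (h : CherednikRel a b pa pb s) (σ : Equiv.Perm (Fin n)) (T : Finset (Fin n)) :
    s σ * pb T = pb (T.map σ.toEmbedding) * s σ := by
  induction T using Finset.induction_on with
  | empty => simp [h.pb_empty]
  | insert j T hj ih =>
    rw [h.pb_insert j T hj, Finset.map_insert, h.pb_insert _ _ (by simpa using hj),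
      ← mul_assoc, h.s_b, mul_assoc, ih, mul_assoc]
    rfl

theorem map_eq_of_fixes {σ : Equiv.Perm (Fin n)} {T : Finset (Fin n)}
    (hT : ∀ i ∈ T, σ i = i) : T.map σ.toEmbedding = T := by
  rw [Finset.map_eq_image]
  conv_rhs => rw [← Finset.image_id (s := T)]
  exact Finset.image_congr fun i hi => hT i hi

theorem swap_fixes {i j : Fin n} {T : Finset (Fin n)} (hi : i ∉ T) (hj : j ∉ T) :
    ∀ l ∈ T, Equiv.swap i j l = l := fun _ hl =>
  Equiv.swap_apply_of_ne_of_ne (fun e => hi (e ▸ hl)) (fun e => hj (e ▸ hl))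

theorem s_pa_of_fixes (h : CherednikRel a b pa pb s) {σ : Equiv.Perm (Fin n)}
    {T : Finset (Fin n)} (hT : ∀ i ∈ T, σ i = i) : s σ * pa T = pa T * s σ := by
  rw [h.s_pa, map_eq_of_fixes hT]

theorem s_pb_of_fixes (h : CherednikRel a b pa pb s) {σ : Equiv.Perm (Fin n)}
    {T : Finset (Fin n)} (hT : ∀ i ∈ T, σ i = i) : s σ * pb T = pb T * s σ := by
  rw [h.s_pb, map_eq_of_fixes hT]

theorem b_pa_of_notMem (h : CherednikRel a b pa pb s) (k : Fin n) (T : Finset (Fin n))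
    (hk : k ∉ T) :
    b k * pa T = pa T * b k - ∑ i ∈ T, pa (T.erase i) * s (Equiv.swap i k) := by
  induction T using Finset.induction_on with
  | empty => simp [h.pa_empty]
  | insert j T hj ih =>
    have hkT : k ∉ T := fun e => hk (Finset.mem_insert_of_mem e)
    have hkj : k ≠ j := fun e => hk (e ▸ Finset.mem_insert_self _ _)
    have key : ∑ i ∈ T, pa ((insert j T).erase i) * s (Equiv.swap i k)
        = a j * ∑ i ∈ T, pa (T.erase i) * s (Equiv.swap i k) := by
      rw [Finset.mul_sum]
      refine Finset.sum_congr rfl fun i hi => ?_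
      have hij : j ≠ i := fun e => hj (e ▸ hi)
      rw [Finset.erase_insert_of_ne hij, h.pa_insert _ _ (fun e => hj (Finset.mem_of_mem_erase e)),
        mul_assoc]
    rw [Finset.sum_insert hj, Finset.erase_insert hj, key, h.pa_insert j T hj, ← mul_assoc,
      h.b_a_ne k j hkj, sub_mul, mul_assoc, ih hkT, h.s_pa_of_fixes (swap_fixes hkT hj),
      Equiv.swap_comm k j]
    noncomm_ring

theorem b_pa_of_mem (h : CherednikRel a b pa pb s) (k : Fin n) (T : Finset (Fin n))
    (hk : k ∈ T) :
    b k * pa T = pa T * b k + ∑ j ∈ Tᶜ, pa (T.erase k) * s (Equiv.swap k j) := by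
  obtain ⟨S, hkS, rfl⟩ : ∃ S, k ∉ S ∧ insert k S = T :=
    ⟨T.erase k, Finset.notMem_erase _ _, Finset.insert_erase hk⟩
  rw [Finset.erase_insert hkS, h.pa_insert k S hkS, ← mul_assoc, h.b_a_self, add_mul, mul_assoc,
    h.b_pa_of_notMem k S hkS]
  have hsplit : Finset.univ.erase k = S ∪ (insert k S)ᶜ := by
    ext x
    by_cases hx : x = k <;> by_cases hxS : x ∈ S <;> simp_all
  have hdisj : Disjoint S (insert k S)ᶜ := by
    rw [Finset.disjoint_left]
    intro x hx
    simp [hx]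
  rw [hsplit, Finset.sum_union hdisj, add_mul, Finset.sum_mul, Finset.sum_mul]
  have h1 : ∑ i ∈ S, s (Equiv.swap k i) * pa S
      = a k * ∑ i ∈ S, pa (S.erase i) * s (Equiv.swap i k) := by
    rw [Finset.mul_sum]
    refine Finset.sum_congr rfl fun i hi => ?_
    have hkS' : k ∉ S.erase i := fun e => hkS (Finset.mem_of_mem_erase e)
    conv_lhs => rw [← Finset.insert_erase hi]
    rw [h.pa_insert _ _ (Finset.notMem_erase _ _), ← mul_assoc, h.s_a, Equiv.swap_apply_right,
      mul_assoc, h.s_pa_of_fixes (swap_fixes hkS' (Finset.notMem_erase _ _)), Equiv.swap_comm]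
  have h2 : ∑ i ∈ (insert k S)ᶜ, s (Equiv.swap k i) * pa S
      = ∑ j ∈ (insert k S)ᶜ, pa S * s (Equiv.swap k j) := by
    refine Finset.sum_congr rfl fun i hi => h.s_pa_of_fixes (swap_fixes hkS ?_)
    simp only [Finset.mem_compl, Finset.mem_insert, not_or] at hi
    exact hi.2
  rw [h1, h2]
  noncomm_ring

/-- Pairs `(T, σ)` with `T ⊆ Fix σ` and `σ k ≠ k`. -/
def movingPairs (k : Fin n) : Finset (Finset (Fin n) × Equiv.Perm (Fin n)) :=
  (fixedPairs n).filter fun x => x.2 k ≠ k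

theorem mem_fixedPairs {x : Finset (Fin n) × Equiv.Perm (Fin n)} :
    x ∈ fixedPairs n ↔ ∀ i ∈ x.1, x.2 i = i := by
  simp [fixedPairs]

theorem mem_movingPairs {k : Fin n} {x : Finset (Fin n) × Equiv.Perm (Fin n)} :
    x ∈ movingPairs k ↔ (∀ i ∈ x.1, x.2 i = i) ∧ x.2 k ≠ k := by
  simp [movingPairs, mem_fixedPairs]

theorem pairSign_erase_swap {T : Finset (Fin n)} {σ : Equiv.Perm (Fin n)} {i l m : Fin n}
    (hi : i ∈ T) (hlm : l ≠ m) :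
    pairSign (T, σ) = pairSign (T.erase i, Equiv.swap l m * σ) := by
  have hc : T.card = (T.erase i).card + 1 := (Finset.card_erase_add_one hi).symm
  simp only [pairSign, Equiv.Perm.sign_mul, Equiv.Perm.sign_swap hlm, hc, pow_succ]
  push_cast
  ring

theorem inv_apply_notMem {k : Fin n} {S : Finset (Fin n)} {τ : Equiv.Perm (Fin n)}
    (hτ : ∀ i ∈ S, τ i = i) (hk : τ k ≠ k) : τ⁻¹ k ∉ S := fun e => by
  have h1 : τ (τ⁻¹ k) = k := τ.apply_symm_apply k
  have h2 := h1.symm.trans (hτ _ e)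
  exact hk ((congrArg τ h2).trans h1)

theorem sum_notMem_eq (h : CherednikRel a b pa pb s) (k : Fin n) :
    ∑ x ∈ (fixedPairs n).filter (fun x => k ∉ x.1), ∑ i ∈ x.1,
        pairSign x • (pa (x.1.erase i) * s (Equiv.swap i k) * pb x.1 * s x.2)
      = ∑ x ∈ movingPairs k, pairSign x • (pa x.1 * pb x.1 * b k * s x.2) := by
  rw [Finset.sum_sigma']
  refine Finset.sum_bij' (fun y _ => (y.1.1.erase y.2, Equiv.swap y.2 k * y.1.2))
    (fun x _ => ⟨(insert (x.2⁻¹ k) x.1, Equiv.swap (x.2⁻¹ k) k * x.2), x.2⁻¹ k⟩) ?_ ?_ ?_ ?_ ?_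
  · rintro ⟨⟨T, σ⟩, i⟩ hy
    simp only [Finset.mem_sigma, Finset.mem_filter, mem_fixedPairs] at hy
    obtain ⟨⟨hσ, hk⟩, hi⟩ := hy
    have hik : i ≠ k := fun e => hk (e ▸ hi)
    rw [mem_movingPairs]
    refine ⟨fun l hl => ?_, fun e => ?_⟩
    · rw [Finset.mem_erase] at hl
      simp only [Equiv.Perm.mul_apply, hσ l hl.2]
      exact Equiv.swap_apply_of_ne_of_ne hl.1 (fun e => hk (e ▸ hl.2))
    · simp only [Equiv.Perm.mul_apply] at e
      rw [Equiv.swap_apply_eq_iff, Equiv.swap_apply_right] at e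
      exact hik (σ.injective ((hσ i hi).trans e.symm))
  · rintro ⟨S, τ⟩ hx
    rw [mem_movingPairs] at hx
    obtain ⟨hτ, hk⟩ := hx
    simp only at hτ hk
    have hne : τ⁻¹ k ≠ k := fun e => hk (by rw [Equiv.Perm.inv_eq_iff_eq] at e; exact e.symm)
    have hkS : k ∉ S := fun e => hk (hτ k e)
    have hiS : τ⁻¹ k ∉ S := inv_apply_notMem hτ hk
    simp only [Finset.mem_sigma, Finset.mem_filter, mem_fixedPairs]
    refine ⟨⟨fun l hl => ?_, ?_⟩, Finset.mem_insert_self _ _⟩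
    · rw [Finset.mem_insert] at hl
      rcases hl with rfl | hl
      · simp
      · simp only [Equiv.Perm.mul_apply, hτ l hl]
        exact swap_fixes hiS hkS l hl
    · rw [Finset.mem_insert]
      rintro (e | e)
      · exact hne e.symm
      · exact hkS e
  · rintro ⟨⟨T, σ⟩, i⟩ hy
    simp only [Finset.mem_sigma, Finset.mem_filter, mem_fixedPairs] at hy
    obtain ⟨⟨hσ, hk⟩, hi⟩ := hy
    have e : σ⁻¹ i = i := by rw [Equiv.Perm.inv_eq_iff_eq, hσ i hi]
    have e2 : (Equiv.swap i k * σ)⁻¹ k = i := by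
      rw [Equiv.Perm.inv_eq_iff_eq, Equiv.Perm.mul_apply, hσ i hi, Equiv.swap_apply_left]
    simp only [e2, Finset.insert_erase hi, ← mul_assoc, Equiv.swap_mul_self, one_mul]
  · rintro ⟨S, τ⟩ hx
    rw [mem_movingPairs] at hx
    obtain ⟨hτ, hk⟩ := hx
    simp only at hτ hk
    have hkS : k ∉ S := fun e => hk (hτ k e)
    have hiS : τ⁻¹ k ∉ S := inv_apply_notMem hτ hk
    simp only [Finset.erase_insert hiS, ← mul_assoc, Equiv.swap_mul_self, one_mul]
  · rintro ⟨⟨T, σ⟩, i⟩ hy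
    simp only [Finset.mem_sigma, Finset.mem_filter, mem_fixedPairs] at hy
    obtain ⟨⟨hσ, hk⟩, hi⟩ := hy
    have hik : i ≠ k := fun e => hk (e ▸ hi)
    simp only [pairSign_erase_swap hi hik]
    congr 1
    have hkS : k ∉ T.erase i := fun e => hk (Finset.mem_of_mem_erase e)
    have hb : s (Equiv.swap i k) * pb T = pb (T.erase i) * b k * s (Equiv.swap i k) := by
      conv_lhs => rw [← Finset.insert_erase hi]
      rw [h.pb_insert _ _ (Finset.notMem_erase _ _), ← mul_assoc, h.s_b, Equiv.swap_apply_left,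
        mul_assoc, h.s_pb_of_fixes (swap_fixes (Finset.notMem_erase _ _) hkS), ← mul_assoc,
        h.commute_b]
    rw [mul_assoc (pa _) (s _), hb, h.s_mul]
    noncomm_ring

theorem sum_mem_eq (h : CherednikRel a b pa pb s) (k : Fin n) :
    ∑ x ∈ (fixedPairs n).filter (fun x => k ∈ x.1), ∑ j ∈ x.1ᶜ,
        pairSign x • (pa (x.1.erase k) * s (Equiv.swap k j) * pb x.1 * s x.2)
      = ∑ x ∈ movingPairs k, pairSign x • (pa x.1 * pb x.1 * b (x.2 k) * s x.2) := by
  rw [Finset.sum_sigma']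
  refine Finset.sum_bij' (fun y _ => (y.1.1.erase k, Equiv.swap k y.2 * y.1.2))
    (fun x _ => ⟨(insert k x.1, Equiv.swap k (x.2 k) * x.2), x.2 k⟩) ?_ ?_ ?_ ?_ ?_
  · rintro ⟨⟨T, σ⟩, j⟩ hy
    simp only [Finset.mem_sigma, Finset.mem_filter, mem_fixedPairs, Finset.mem_compl] at hy
    obtain ⟨⟨hσ, hk⟩, hj⟩ := hy
    have hjk : j ≠ k := fun e => hj (e ▸ hk)
    rw [mem_movingPairs]
    refine ⟨fun l hl => ?_, ?_⟩
    · rw [Finset.mem_erase] at hl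
      simp only [Equiv.Perm.mul_apply, hσ l hl.2]
      exact Equiv.swap_apply_of_ne_of_ne hl.1 (fun e => hj (e ▸ hl.2))
    · simpa only [Equiv.Perm.mul_apply, hσ k hk, Equiv.swap_apply_left] using hjk
  · rintro ⟨S, τ⟩ hx
    rw [mem_movingPairs] at hx
    obtain ⟨hτ, hk⟩ := hx
    simp only at hτ hk
    have hkS : k ∉ S := fun e => hk (hτ k e)
    have hjS : τ k ∉ S := fun e => hk (τ.injective (hτ _ e))
    simp only [Finset.mem_sigma, Finset.mem_filter, mem_fixedPairs, Finset.mem_compl]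
    refine ⟨⟨fun l hl => ?_, Finset.mem_insert_self _ _⟩, ?_⟩
    · rw [Finset.mem_insert] at hl
      rcases hl with rfl | hl
      · simp
      · simp only [Equiv.Perm.mul_apply, hτ l hl]
        exact swap_fixes hkS hjS l hl
    · rw [Finset.mem_insert]
      rintro (e | e)
      · exact hk e
      · exact hjS e
  · rintro ⟨⟨T, σ⟩, j⟩ hy
    simp only [Finset.mem_sigma, Finset.mem_filter, mem_fixedPairs, Finset.mem_compl] at hy
    obtain ⟨⟨hσ, hk⟩, hj⟩ := hy
    have e : (Equiv.swap k j * σ) k = j := by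
      rw [Equiv.Perm.mul_apply, hσ k hk, Equiv.swap_apply_left]
    simp only [e, Finset.insert_erase hk, ← mul_assoc, Equiv.swap_mul_self, one_mul]
  · rintro ⟨S, τ⟩ hx
    rw [mem_movingPairs] at hx
    obtain ⟨hτ, hk⟩ := hx
    simp only at hτ hk
    have hkS : k ∉ S := fun e => hk (hτ k e)
    simp only [Finset.erase_insert hkS, ← mul_assoc, Equiv.swap_mul_self, one_mul]
  · rintro ⟨⟨T, σ⟩, j⟩ hy
    simp only [Finset.mem_sigma, Finset.mem_filter, mem_fixedPairs, Finset.mem_compl] at hy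
    obtain ⟨⟨hσ, hk⟩, hj⟩ := hy
    have hkj : k ≠ j := fun e => hj (e ▸ hk)
    have e : (Equiv.swap k j * σ) k = j := by
      rw [Equiv.Perm.mul_apply, hσ k hk, Equiv.swap_apply_left]
    simp only [pairSign_erase_swap hk hkj, e]
    congr 1
    have hjS : j ∉ T.erase k := fun e => hj (Finset.mem_of_mem_erase e)
    have hb : s (Equiv.swap k j) * pb T = pb (T.erase k) * b j * s (Equiv.swap k j) := by
      conv_lhs => rw [← Finset.insert_erase hk]
      rw [h.pb_insert _ _ (Finset.notMem_erase _ _), ← mul_assoc, h.s_b, Equiv.swap_apply_left,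
        mul_assoc, h.s_pb_of_fixes (swap_fixes (Finset.notMem_erase _ _) hjS), ← mul_assoc,
        h.commute_b]
    rw [mul_assoc (pa _) (s _), hb, h.s_mul]
    noncomm_ring

theorem centralSum_mul_b (h : CherednikRel a b pa pb s) (k : Fin n) :
    centralSum pa pb s * b k = b k * centralSum pa pb s := by
  have hL : centralSum pa pb s * b k
      = ∑ x ∈ fixedPairs n, pairSign x • (pa x.1 * pb x.1 * b (x.2 k) * s x.2) := by
    rw [centralSum, Finset.sum_mul]
    refine Finset.sum_congr rfl fun x _ => ?_
    rw [smul_mul_assoc, mul_assoc, h.s_b, ← mul_assoc]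
  have hR : b k * centralSum pa pb s
      = ∑ x ∈ fixedPairs n, pairSign x • (pa x.1 * pb x.1 * b k * s x.2)
        - ∑ x ∈ (fixedPairs n).filter (fun x => k ∉ x.1), ∑ i ∈ x.1,
          pairSign x • (pa (x.1.erase i) * s (Equiv.swap i k) * pb x.1 * s x.2)
        + ∑ x ∈ (fixedPairs n).filter (fun x => k ∈ x.1), ∑ j ∈ x.1ᶜ,
          pairSign x • (pa (x.1.erase k) * s (Equiv.swap k j) * pb x.1 * s x.2) := by
    rw [centralSum, Finset.mul_sum, Finset.sum_filter, Finset.sum_filter,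
      ← Finset.sum_sub_distrib, ← Finset.sum_add_distrib]
    refine Finset.sum_congr rfl fun x _ => ?_
    have e1 : pa x.1 * pb x.1 * b k * s x.2 = pa x.1 * b k * pb x.1 * s x.2 := by
      rw [mul_assoc (pa x.1), ← h.commute_b, ← mul_assoc]
    by_cases hk : k ∈ x.1
    · simp only [hk, not_true_eq_false, if_true, if_false, sub_zero]
      rw [← Finset.smul_sum, ← smul_add, mul_smul_comm, e1, ← Finset.sum_mul, ← Finset.sum_mul,
        ← add_mul, ← add_mul, ← h.b_pa_of_mem k _ hk]
      simp only [mul_assoc]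
    · simp only [hk, not_false_eq_true, if_true, if_false, add_zero]
      rw [← Finset.smul_sum, ← smul_sub, mul_smul_comm, e1, ← Finset.sum_mul, ← Finset.sum_mul,
        ← sub_mul, ← sub_mul, ← h.b_pa_of_notMem k _ hk]
      simp only [mul_assoc]
  rw [hL, hR, h.sum_notMem_eq, h.sum_mem_eq]
  have hsplit : ∀ f : Finset (Fin n) × Equiv.Perm (Fin n) → A,
      ∑ x ∈ fixedPairs n, f x = ∑ x ∈ movingPairs k, f x
        + ∑ x ∈ (fixedPairs n).filter (fun x => ¬ x.2 k ≠ k), f x := fun f =>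
    (Finset.sum_filter_add_sum_filter_not _ _ _).symm
  rw [hsplit, hsplit fun x => pairSign x • (pa x.1 * pb x.1 * b k * s x.2)]
  have : ∑ x ∈ (fixedPairs n).filter (fun x => ¬ x.2 k ≠ k),
        pairSign x • (pa x.1 * pb x.1 * b (x.2 k) * s x.2)
      = ∑ x ∈ (fixedPairs n).filter (fun x => ¬ x.2 k ≠ k),
        pairSign x • (pa x.1 * pb x.1 * b k * s x.2) := by
    refine Finset.sum_congr rfl fun x hx => ?_
    have := (Finset.mem_filter.1 hx).2
    rw [not_not] at this
    rw [this]
  rw [this]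
  abel

theorem centralSum_mul_s (h : CherednikRel a b pa pb s) (τ : Equiv.Perm (Fin n)) :
    centralSum pa pb s * s τ = s τ * centralSum pa pb s := by
  rw [centralSum, Finset.sum_mul, Finset.mul_sum]
  symm
  refine Finset.sum_bij' (fun x _ => (x.1.map τ.toEmbedding, τ * x.2 * τ⁻¹))
    (fun x _ => (x.1.map (τ⁻¹).toEmbedding, τ⁻¹ * x.2 * τ)) ?_ ?_ ?_ ?_ ?_
  · rintro ⟨T, σ⟩ hx
    rw [mem_fixedPairs] at hx ⊢
    simp only [Finset.mem_map, forall_exists_index, and_imp]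
    rintro _ i hi rfl
    simp [hx i hi]
  · rintro ⟨T, σ⟩ hx
    rw [mem_fixedPairs] at hx ⊢
    simp only [Finset.mem_map, forall_exists_index, and_imp]
    rintro _ i hi rfl
    simp [hx i hi]
  · rintro ⟨T, σ⟩ _
    refine Prod.ext ?_ (by group)
    simp [Finset.map_map]
  · rintro ⟨T, σ⟩ _
    refine Prod.ext ?_ (by group)
    simp [Finset.map_map]
  · rintro ⟨T, σ⟩ _
    have e : pairSign (T.map τ.toEmbedding, τ * σ * τ⁻¹) = pairSign (T, σ) := by
      simp only [pairSign, map_mul, Finset.card_map, Equiv.Perm.sign_inv]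
      rw [mul_right_comm, Int.units_mul_self, one_mul]
    rw [e, mul_smul_comm, smul_mul_assoc]
    congr 1
    simp only
    rw [← mul_assoc, ← mul_assoc, h.s_pa, mul_assoc (pa _), h.s_pb, mul_assoc _ (s _) (s τ),
      ← h.s_mul, inv_mul_cancel_right, h.s_mul]
    simp only [mul_assoc]

open MulOpposite in
/-- Exchanging the two families gives the same relations in the opposite ring. -/
theorem op (h : CherednikRel a b pa pb s) :
    CherednikRel (fun i => op (b i)) (fun i => op (a i)) (fun T => op (pb T))
      (fun T => op (pa T)) (fun σ => op (s σ⁻¹)) where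
  s_one := by simp [h.s_one]
  s_mul σ τ := by simp [h.s_mul]
  s_a σ i := by
    rw [← op_mul, ← op_mul, h.s_b, show σ⁻¹ (σ i) = i from σ.symm_apply_apply i]
  s_b σ i := by
    rw [← op_mul, ← op_mul, h.s_a, show σ⁻¹ (σ i) = i from σ.symm_apply_apply i]
  comm_a i j := by rw [← op_mul, ← op_mul, h.comm_b]
  comm_b i j := by rw [← op_mul, ← op_mul, h.comm_a]
  b_a_ne i j hij := by
    rw [← op_mul, ← op_mul, h.b_a_ne j i hij.symm, Equiv.swap_inv, Equiv.swap_comm, op_sub]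
  b_a_self i := by
    simp_rw [← op_mul, h.b_a_self i, Equiv.swap_inv, op_add, ← Finset.op_sum]
  pa_empty := by simp [h.pb_empty]
  pb_empty := by simp [h.pa_empty]
  pa_insert i T hi := by rw [← op_mul, h.pb_insert i T hi, h.commute_b]
  pb_insert i T hi := by rw [← op_mul, h.pa_insert i T hi, h.commute_a]

open MulOpposite in
theorem centralSum_op (h : CherednikRel a b pa pb s) :
    centralSum (fun T => MulOpposite.op (pb T)) (fun T => MulOpposite.op (pa T))
      (fun σ => MulOpposite.op (s σ⁻¹)) = MulOpposite.op (centralSum pa pb s) := by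
  rw [centralSum, centralSum, Finset.op_sum]
  refine Finset.sum_bij' (fun x _ => (x.1, x.2⁻¹)) (fun x _ => (x.1, x.2⁻¹)) ?_ ?_ ?_ ?_ ?_
  · rintro ⟨T, σ⟩ hx
    rw [mem_fixedPairs] at hx ⊢
    exact fun i hi => by rw [Equiv.Perm.inv_eq_iff_eq, hx i hi]
  · rintro ⟨T, σ⟩ hx
    rw [mem_fixedPairs] at hx ⊢
    exact fun i hi => by rw [Equiv.Perm.inv_eq_iff_eq, hx i hi]
  · simp
  · simp
  · rintro ⟨T, σ⟩ hx
    rw [mem_fixedPairs] at hx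
    have hf : ∀ i ∈ T, σ⁻¹ i = i := fun i hi => by rw [Equiv.Perm.inv_eq_iff_eq, hx i hi]
    have e : pairSign (T, σ⁻¹) = pairSign (T, σ) := by simp [pairSign]
    simp only
    rw [e, op_smul, ← op_mul, ← op_mul, ← mul_assoc, h.s_pa_of_fixes hf, mul_assoc,
      h.s_pb_of_fixes hf, ← mul_assoc]

theorem centralSum_mul_a (h : CherednikRel a b pa pb s) (k : Fin n) :
    centralSum pa pb s * a k = a k * centralSum pa pb s := by
  have := h.op.centralSum_mul_b k
  rw [h.centralSum_op, ← MulOpposite.op_mul, ← MulOpposite.op_mul] at this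
  exact (MulOpposite.op_injective this).symm

end CherednikRel

section RingIdentities

variable {A : Type*} [Ring A]

theorem commutator_mul_of_sum_eq {a b x s S : A} (hb : b * x = x * b + S) (ha : a * x = x * a - s)
    (hS : a * S = S * a + a * s - s * a) (hsa : s * a = b * s) (hsb : s * b = a * s) :
    (a * b - b * a) * x = x * (a * b - b * a) := by
  have e1 : a * b * x = x * a * b - s * b + a * S := by
    rw [mul_assoc, hb, mul_add, ← mul_assoc, ha, sub_mul]
  have e2 : b * a * x = x * b * a + S * a - b * s := by
    rw [mul_assoc, ha, mul_sub, ← mul_assoc, hb, add_mul]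
  rw [sub_mul, e1, e2, hS, hsb, ← hsa]
  noncomm_ring

theorem commutator_mul_of_commute {a b x s t : A} (ha : a * x = x * a - s) (hb : b * x = x * b - t)
    (hsb : s * b = b * s) (hta : t * a = a * t) :
    (a * b - b * a) * x = x * (a * b - b * a) := by
  have e1 : a * b * x = x * a * b - s * b - a * t := by
    rw [mul_assoc, hb, mul_sub, ← mul_assoc, ha, sub_mul]
  have e2 : b * a * x = x * b * a - t * a - b * s := by
    rw [mul_assoc, ha, mul_sub, ← mul_assoc, hb, sub_mul]
  rw [sub_mul, e1, e2, hsb, hta]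
  noncomm_ring

theorem commutator_mul_symm {a b x : A} (h : (b * a - a * b) * x = x * (b * a - a * b)) :
    (a * b - b * a) * x = x * (a * b - b * a) := by
  rw [← neg_sub, neg_mul, mul_neg, h]

theorem smul_one_sub_mul_comm [Algebra ℂ A] (u v : ℂ) {a b c : A} (h : a * b = b * a + c) :
    (u • (1 : A) - a) * (v • (1 : A) - b) = (v • (1 : A) - b) * (u • (1 : A) - a) + c := by
  simp only [sub_mul, mul_sub, smul_mul_assoc, mul_smul_comm, mul_one, one_mul, h,
    smul_sub, smul_comm v u (1 : A)]
  abel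

theorem smul_one_sub_mul_comm_of_sub [Algebra ℂ A] (u v : ℂ) {a b c : A} (h : a * b = b * a - c) :
    (u • (1 : A) - a) * (v • (1 : A) - b) = (v • (1 : A) - b) * (u • (1 : A) - a) - c := by
  rw [smul_one_sub_mul_comm u v (h.trans (sub_eq_add_neg _ _)), ← sub_eq_add_neg]

theorem smul_one_sub_mul_comm_of_commute [Algebra ℂ A] (u v : ℂ) {a b : A} (h : a * b = b * a) :
    (u • (1 : A) - a) * (v • (1 : A) - b) = (v • (1 : A) - b) * (u • (1 : A) - a) := by
  rw [smul_one_sub_mul_comm u v (h.trans (add_zero _).symm), add_zero]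

theorem mul_comm_of_mul_smul_one_sub [Algebra ℂ A] {u : ℂ} {p a : A}
    (h : p * (u • (1 : A) - a) = (u • (1 : A) - a) * p) : p * a = a * p := by
  simpa only [mul_sub, sub_mul, mul_smul_comm, smul_mul_assoc, mul_one, one_mul,
    sub_right_inj] using h

end RingIdentities

section Operators

variable {N : ℕ} {D : Fin N → Fin N → Rzl N → Rzl N} {K : Fin N → Module.End ℂ (Rzl N)}

theorem X_inr_sub_ne_zero {i j : Fin N} (hij : i ≠ j) :
    (X (Sum.inr i) - X (Sum.inr j) : Rzl N) ≠ 0 :=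
  sub_ne_zero.2 fun e => hij (Sum.inr_injective (X_injective e))

theorem permHat_sL (σ : Equiv.Perm (Fin N)) (i j : Fin N) (p : Rzl N) :
    permHat N σ (sL N i j p) = sL N (σ i) (σ j) (permHat N σ p) := by
  simp only [permHat, sL, renameEquiv_apply, rename_rename]
  refine congrArg (fun f => rename f p) (funext ?_)
  rintro (x | x) <;>
    simp only [Function.comp_apply, Equiv.sumCongr_apply, Sum.map_inl, Sum.map_inr,
      Equiv.refl_apply, σ.injective.swap_apply]

theorem permHat_sZ (σ : Equiv.Perm (Fin N)) (i j : Fin N) (p : Rzl N) :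
    permHat N σ (sZ N i j p) = sZ N (σ i) (σ j) (permHat N σ p) := by
  simp only [permHat, sZ, renameEquiv_apply, rename_rename]
  refine congrArg (fun f => rename f p) (funext ?_)
  rintro (x | x) <;>
    simp only [Function.comp_apply, Equiv.sumCongr_apply, Sum.map_inl, Sum.map_inr,
      Equiv.refl_apply, σ.injective.swap_apply]

theorem sZ_sL (i j : Fin N) (p : Rzl N) :
    sZ N i j (sL N i j p) = permHat N (Equiv.swap i j) p := by
  simp only [permHat, sZ, sL, renameEquiv_apply, rename_rename]
  refine congrArg (fun f => rename f p) (funext ?_)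
  rintro (x | x) <;>
    simp only [Function.comp_apply, Equiv.sumCongr_apply, Sum.map_inl, Sum.map_inr,
      Equiv.refl_apply]

theorem sL_X_inr (i j m : Fin N) :
    sL N i j (X (Sum.inr m)) = X (Sum.inr (Equiv.swap i j m)) := by
  simp only [sL, renameEquiv_apply, rename_X, Equiv.sumCongr_apply, Sum.map_inr]

theorem sZ_X_inr (i j m : Fin N) : sZ N i j (X (Sum.inr m)) = X (Sum.inr m) := by
  simp only [sZ, renameEquiv_apply, rename_X, Equiv.sumCongr_apply, Sum.map_inr, Equiv.refl_apply]

theorem permHat_divDiff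
    (hD : ∀ i j : Fin N, i ≠ j → ∀ p : Rzl N,
      (X (Sum.inr i) - X (Sum.inr j)) * D i j p = p - sL N i j p)
    (σ : Equiv.Perm (Fin N)) {i j : Fin N} (hij : i ≠ j) (p : Rzl N) :
    permHat N σ (D i j p) = D (σ i) (σ j) (permHat N σ p) := by
  have hσ : σ i ≠ σ j := fun e => hij (σ.injective e)
  apply mul_left_cancel₀ (X_inr_sub_ne_zero hσ)
  rw [hD _ _ hσ, ← permHat_sL, ← map_sub, ← hD i j hij, map_mul, map_sub]
  simp [permHat]

theorem divDiff_X_inr_mul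
    (hD : ∀ i j : Fin N, i ≠ j → ∀ p : Rzl N,
      (X (Sum.inr i) - X (Sum.inr j)) * D i j p = p - sL N i j p)
    {i j : Fin N} (hij : i ≠ j) (m : Fin N) (p : Rzl N) :
    D i j (X (Sum.inr m) * p) = X (Sum.inr m) * D i j p
      + ((if m = i then 1 else 0) - (if m = j then 1 else 0)) * sL N i j p := by
  apply mul_left_cancel₀ (X_inr_sub_ne_zero hij)
  rw [hD _ _ hij, mul_add, mul_left_comm, hD _ _ hij, map_mul, sL_X_inr]
  by_cases hi : m = i
  · subst hi
    simp only [hij, if_true, if_false, Equiv.swap_apply_left]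
    ring
  · by_cases hj : m = j
    · subst hj
      simp only [hi, if_true, if_false, Equiv.swap_apply_right]
      ring
    · simp only [hi, hj, if_false, Equiv.swap_apply_of_ne_of_ne hi hj]
      ring

theorem divDiff_rename_inl
    (hD : ∀ i j : Fin N, i ≠ j → ∀ p : Rzl N,
      (X (Sum.inr i) - X (Sum.inr j)) * D i j p = p - sL N i j p)
    {i j : Fin N} (hij : i ≠ j) (q : MvPolynomial (Fin N) ℂ) :
    D i j (rename Sum.inl q) = 0 := by
  apply mul_left_cancel₀ (X_inr_sub_ne_zero hij)
  rw [hD _ _ hij, mul_zero, sub_eq_zero, sL, renameEquiv_apply, rename_rename]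
  congr 1

theorem permOp_mul_mulP (σ : Equiv.Perm (Fin N)) (p : Rzl N) :
    permOp N σ * mulP N p = mulP N (permHat N σ p) * permOp N σ := by
  refine LinearMap.ext fun q => ?_
  simp [permOp, mulP]

theorem permOp_mul (σ τ : Equiv.Perm (Fin N)) : permOp N (σ * τ) = permOp N σ * permOp N τ := by
  refine LinearMap.ext fun p => ?_
  simp only [permOp, permHat, Module.End.mul_apply, AlgEquiv.toLinearMap_apply,
    renameEquiv_apply, rename_rename]
  congr 1
  ext x
  rcases x with x | x <;> simp

theorem permOp_one : permOp N 1 = 1 := by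
  refine LinearMap.ext fun p => ?_
  simp [permOp, permHat]

theorem permOp_mul_K
    (hD : ∀ i j : Fin N, i ≠ j → ∀ p : Rzl N,
      (X (Sum.inr i) - X (Sum.inr j)) * D i j p = p - sL N i j p)
    (hK : ∀ (i : Fin N) (p : Rzl N),
      K i p = X (Sum.inl i) * p + ∑ j ∈ Finset.univ.erase i, sZ N i j (D i j p))
    (σ : Equiv.Perm (Fin N)) (i : Fin N) :
    permOp N σ * K i = K (σ i) * permOp N σ := by
  refine LinearMap.ext fun p => ?_
  simp only [Module.End.mul_apply, hK, permOp, AlgEquiv.toLinearMap_apply, map_add, map_mul,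
    map_sum]
  congr 1
  · simp [permHat]
  · refine Finset.sum_equiv σ (by simp) fun j hj => ?_
    rw [permHat_sZ, permHat_divDiff hD σ (Finset.ne_of_mem_erase hj).symm]

theorem K_mul_mulP
    (hD : ∀ i j : Fin N, i ≠ j → ∀ p : Rzl N,
      (X (Sum.inr i) - X (Sum.inr j)) * D i j p = p - sL N i j p)
    (hK : ∀ (i : Fin N) (p : Rzl N),
      K i p = X (Sum.inl i) * p + ∑ j ∈ Finset.univ.erase i, sZ N i j (D i j p))
    (i m : Fin N) :
    K i * mulP N (X (Sum.inr m)) = mulP N (X (Sum.inr m)) * K i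
      + ∑ j ∈ Finset.univ.erase i,
        ((if m = i then 1 else 0) - (if m = j then 1 else 0) : Module.End ℂ (Rzl N))
          * permOp N (Equiv.swap i j) := by
  refine LinearMap.ext fun p => ?_
  simp only [Module.End.mul_apply, mulP, LinearMap.mulLeft_apply, hK, LinearMap.add_apply,
    LinearMap.sum_apply]
  rw [mul_add, add_assoc, Finset.mul_sum, ← Finset.sum_add_distrib, mul_left_comm]
  congr 1
  refine Finset.sum_congr rfl fun j hj => ?_
  rw [divDiff_X_inr_mul hD (Finset.ne_of_mem_erase hj).symm, map_add, map_mul, map_mul, sZ_sL]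
  congr 1
  · rw [sZ_X_inr]
  · split_ifs <;> simp [permOp]

theorem K_mul_mulP_self
    (hD : ∀ i j : Fin N, i ≠ j → ∀ p : Rzl N,
      (X (Sum.inr i) - X (Sum.inr j)) * D i j p = p - sL N i j p)
    (hK : ∀ (i : Fin N) (p : Rzl N),
      K i p = X (Sum.inl i) * p + ∑ j ∈ Finset.univ.erase i, sZ N i j (D i j p))
    (i : Fin N) :
    K i * mulP N (X (Sum.inr i)) = mulP N (X (Sum.inr i)) * K i
      + ∑ j ∈ Finset.univ.erase i, permOp N (Equiv.swap i j) := by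
  rw [K_mul_mulP hD hK]
  congr 1
  refine Finset.sum_congr rfl fun j hj => ?_
  simp [(Finset.ne_of_mem_erase hj).symm]

theorem K_mul_mulP_of_ne
    (hD : ∀ i j : Fin N, i ≠ j → ∀ p : Rzl N,
      (X (Sum.inr i) - X (Sum.inr j)) * D i j p = p - sL N i j p)
    (hK : ∀ (i : Fin N) (p : Rzl N),
      K i p = X (Sum.inl i) * p + ∑ j ∈ Finset.univ.erase i, sZ N i j (D i j p))
    {i m : Fin N} (him : i ≠ m) :
    K i * mulP N (X (Sum.inr m)) = mulP N (X (Sum.inr m)) * K i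
      - permOp N (Equiv.swap i m) := by
  rw [K_mul_mulP hD hK, sub_eq_add_neg]
  congr 1
  rw [Finset.sum_eq_single m]
  · rw [if_neg him.symm, if_pos rfl, zero_sub]
    exact neg_one_mul (permOp N (Equiv.swap i m))
  · intro j _ hjm
    simp [him.symm, hjm.symm]
  · intro hm
    simp [him.symm] at hm

/-- Two endomorphisms commuting with all `λ_m` agree once they agree on `ℂ[z]`. -/
theorem eq_of_eq_on_rename_inl {f g : Module.End ℂ (Rzl N)}
    (hf : ∀ m, f * mulP N (X (Sum.inr m)) = mulP N (X (Sum.inr m)) * f)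
    (hg : ∀ m, g * mulP N (X (Sum.inr m)) = mulP N (X (Sum.inr m)) * g)
    (h : ∀ q : MvPolynomial (Fin N) ℂ, f (rename Sum.inl q) = g (rename Sum.inl q)) :
    f = g := by
  have hfm : ∀ m p, f (X (Sum.inr m) * p) = X (Sum.inr m) * f p := fun m p =>
    LinearMap.congr_fun (hf m) p
  have hgm : ∀ m p, g (X (Sum.inr m) * p) = X (Sum.inr m) * g p := fun m p =>
    LinearMap.congr_fun (hg m) p
  have key : ∀ p : Rzl N, ∀ q : MvPolynomial (Fin N) ℂ,
      f (p * rename Sum.inl q) = g (p * rename Sum.inl q) := by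
    intro p
    induction p using MvPolynomial.induction_on with
    | C c => intro q; rw [← smul_eq_C_mul, map_smul, map_smul, h]
    | add p₁ p₂ h₁ h₂ => intro q; rw [add_mul, map_add, map_add, h₁, h₂]
    | mul_X p x hp =>
      intro q
      rcases x with x | x
      · have := hp (X x * q)
        rwa [map_mul (rename Sum.inl), rename_X, ← mul_assoc] at this
      · rw [mul_comm p, mul_assoc, hfm, hgm, hp]
  refine LinearMap.ext fun p => ?_
  simpa using key p 1

theorem K_commute
    (hD : ∀ i j : Fin N, i ≠ j → ∀ p : Rzl N,
      (X (Sum.inr i) - X (Sum.inr j)) * D i j p = p - sL N i j p)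
    (hK : ∀ (i : Fin N) (p : Rzl N),
      K i p = X (Sum.inl i) * p + ∑ j ∈ Finset.univ.erase i, sZ N i j (D i j p))
    (i j : Fin N) : K i * K j = K j * K i := by
  rcases eq_or_ne i j with rfl | hij
  · rfl
  have hKz : ∀ i (q : MvPolynomial (Fin N) ℂ),
      K i (rename Sum.inl q) = rename Sum.inl (X i * q) := by
    intro i q
    rw [hK, Finset.sum_eq_zero, add_zero, map_mul, rename_X]
    intro j hj
    rw [divDiff_rename_inl hD (Finset.ne_of_mem_erase hj).symm, map_zero]
  have hs := permOp_mul_K hD hK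
  rw [← sub_eq_zero]
  refine eq_of_eq_on_rename_inl ?_ (by simp) fun q => ?_
  · have aux : ∀ i j : Fin N, i ≠ j →
        (K i * K j - K j * K i) * mulP N (X (Sum.inr j))
          = mulP N (X (Sum.inr j)) * (K i * K j - K j * K i) := by
      intro i j hij
      have h1 := K_mul_mulP_self hD hK j
      have h2 := K_mul_mulP_of_ne hD hK hij
      have hi : i ∈ Finset.univ.erase j := by simp [hij]
      have h3 : K i * ∑ l ∈ Finset.univ.erase j, permOp N (Equiv.swap j l)
          = (∑ l ∈ Finset.univ.erase j, permOp N (Equiv.swap j l)) * K i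
            + K i * permOp N (Equiv.swap i j) - permOp N (Equiv.swap i j) * K i := by
        rw [← Finset.add_sum_erase _ _ hi, mul_add, add_mul, Finset.mul_sum, Finset.sum_mul,
          Equiv.swap_comm j i]
        have : ∑ l ∈ (Finset.univ.erase j).erase i, K i * permOp N (Equiv.swap j l)
            = ∑ l ∈ (Finset.univ.erase j).erase i, permOp N (Equiv.swap j l) * K i := by
          refine Finset.sum_congr rfl fun l hl => ?_
          rw [hs, Equiv.swap_apply_of_ne_of_ne hij (Finset.ne_of_mem_erase hl).symm]
        rw [this]
        abel
      have h4 := hs (Equiv.swap i j) i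
      have h5 := hs (Equiv.swap i j) j
      rw [Equiv.swap_apply_left] at h4
      rw [Equiv.swap_apply_right] at h5
      exact commutator_mul_of_sum_eq h1 h2 h3 h4 h5
    intro m
    by_cases hmj : m = j
    · subst hmj; exact aux i m hij
    · by_cases hmi : m = i
      · subst hmi
        exact commutator_mul_symm (aux j m hij.symm)
      · have h1 := K_mul_mulP_of_ne hD hK (Ne.symm hmi)
        have h2 := K_mul_mulP_of_ne hD hK (Ne.symm hmj)
        have h3 := hs (Equiv.swap i m) j
        have h4 := hs (Equiv.swap j m) i
        rw [Equiv.swap_apply_of_ne_of_ne hij.symm (Ne.symm hmj)] at h3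
        rw [Equiv.swap_apply_of_ne_of_ne hij (Ne.symm hmi)] at h4
        exact commutator_mul_of_commute h1 h2 h3 h4
  · rw [LinearMap.sub_apply, LinearMap.zero_apply, Module.End.mul_apply, Module.End.mul_apply,
      hKz, hKz, hKz, hKz, mul_left_comm, sub_self]

theorem ordProd_insert {f : Fin N → Module.End ℂ (Rzl N)} (hf : ∀ i j, f i * f j = f j * f i)
    (i : Fin N) (T : Finset (Fin N)) (hi : i ∉ T) :
    ordProd (insert i T) f = f i * ordProd T f := by
  rw [ordProd, ordProd, ← List.prod_cons, ← List.map_cons]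
  refine List.Perm.prod_eq' (List.Perm.map f ?_) ?_
  · rw [← Multiset.coe_eq_coe, ← Multiset.cons_coe, Finset.sort_eq, Finset.sort_eq,
      Finset.insert_val_of_notMem hi]
  · rw [List.pairwise_map]
    exact List.pairwise_of_forall fun x y => hf x y

theorem mulP_C_sub (v : ℂ) (p : Rzl N) :
    mulP N (C v - p) = v • (1 : Module.End ℂ (Rzl N)) - mulP N p := by
  refine LinearMap.ext fun q => ?_
  simp [mulP, sub_mul, smul_eq_C_mul]

theorem cherednikRel_operators
    (hD : ∀ i j : Fin N, i ≠ j → ∀ p : Rzl N,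
      (X (Sum.inr i) - X (Sum.inr j)) * D i j p = p - sL N i j p)
    (hK : ∀ (i : Fin N) (p : Rzl N),
      K i p = X (Sum.inl i) * p + ∑ j ∈ Finset.univ.erase i, sZ N i j (D i j p))
    (u v : ℂ) :
    CherednikRel (fun i => mulP N ((C v : Rzl N) - X (Sum.inr i)))
      (fun i => u • (1 : Module.End ℂ (Rzl N)) - K i)
      (fun T => mulP N (∏ i ∈ T, ((C v : Rzl N) - X (Sum.inr i))))
      (fun T => ordProd T (fun i => u • (1 : Module.End ℂ (Rzl N)) - K i))
      (permOp N) where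
  s_one := permOp_one
  s_mul := permOp_mul
  s_a σ i := by
    rw [permOp_mul_mulP]
    simp [permHat]
  s_b σ i := by
    rw [mul_sub, sub_mul, permOp_mul_K hD hK, mul_smul_comm, smul_mul_assoc, mul_one, one_mul]
  comm_a i j := by
    refine LinearMap.ext fun p => ?_
    simp only [mulP, Module.End.mul_apply, LinearMap.mulLeft_apply]
    ring
  comm_b i j := by
    exact smul_one_sub_mul_comm_of_commute u u (K_commute hD hK i j)
  b_a_ne i j hij := by
    simp only [mulP_C_sub]
    exact smul_one_sub_mul_comm_of_sub u v (K_mul_mulP_of_ne hD hK hij)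
  b_a_self i := by
    simp only [mulP_C_sub]
    exact smul_one_sub_mul_comm u v (K_mul_mulP_self hD hK i)
  pa_empty := by
    refine LinearMap.ext fun p => ?_
    simp [mulP]
  pb_empty := by simp [ordProd]
  pa_insert i T hi := by
    refine LinearMap.ext fun p => ?_
    rw [Finset.prod_insert hi]
    simp only [mulP, Module.End.mul_apply, LinearMap.mulLeft_apply, mul_assoc]
  pb_insert i T hi := by
    refine ordProd_insert (fun i j => ?_) i T hi
    exact smul_one_sub_mul_comm_of_commute u u (K_commute hD hK i j)

theorem Puv_eq_centralSum (K : Fin N → Module.End ℂ (Rzl N)) (u v : ℂ) :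
    Puv K u v = ((-1 : ℤ) ^ N) • CherednikRel.centralSum
      (fun T => mulP N (∏ i ∈ T, ((C v : Rzl N) - X (Sum.inr i))))
      (fun T => ordProd T (fun i => u • (1 : Module.End ℂ (Rzl N)) - K i)) (permOp N) := by
  rw [Puv, CherednikRel.centralSum]
  congr 1
  simp_rw [Finset.sum_mul, Finset.smul_sum]
  rw [Finset.sum_sigma']
  refine Finset.sum_bij' (fun x _ => (x.2, x.1)) (fun x _ => ⟨x.2, x.1⟩) ?_ ?_ ?_ ?_ ?_
  · rintro ⟨σ, T⟩ hx
    simpa [CherednikRel.mem_fixedPairs, Finset.subset_iff] using hx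
  · rintro ⟨T, σ⟩ hx
    simpa [CherednikRel.mem_fixedPairs, Finset.subset_iff] using hx
  · simp
  · simp
  · rintro ⟨σ, T⟩ _
    simp only [CherednikRel.pairSign]
    rw [smul_mul_assoc, smul_smul]

end Operators

set_option synthInstance.maxHeartbeats 1000000 in
/-- For all `u, v`, the operator `P(u,v)` commutes with multiplication by each `λ_i`,
with each `K_i`, and with each `σ̂`; i.e. all coefficients of the universal central
polynomial are central in the Cherednik algebra `H`. -/
theorem stmt6 (N : ℕ) (hN : 0 < N)
    (D : Fin N → Fin N → Rzl N → Rzl N)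
    (hD : ∀ i j : Fin N, i ≠ j → ∀ p : Rzl N,
      (X (Sum.inr i) - X (Sum.inr j)) * D i j p = p - sL N i j p)
    (K : Fin N → Module.End ℂ (Rzl N))
    (hK : ∀ (i : Fin N) (p : Rzl N),
      K i p = X (Sum.inl i) * p + ∑ j ∈ Finset.univ.erase i, sZ N i j (D i j p)) :
    ∀ u v : ℂ,
      (∀ i : Fin N, Puv K u v * mulP N (X (Sum.inr i)) = mulP N (X (Sum.inr i)) * Puv K u v) ∧
      (∀ i : Fin N, Puv K u v * K i = K i * Puv K u v) ∧
      (∀ σ : Equiv.Perm (Fin N), Puv K u v * permOp N σ = permOp N σ * Puv K u v) := by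
  intro u v
  have h := cherednikRel_operators hD hK u v
  refine ⟨fun i => ?_, fun i => ?_, fun σ => ?_⟩
  · rw [Puv_eq_centralSum, smul_mul_assoc, mul_smul_comm]
    congr 1
    refine mul_comm_of_mul_smul_one_sub (u := v) ?_
    rw [← mulP_C_sub]
    exact h.centralSum_mul_a i
  · rw [Puv_eq_centralSum, smul_mul_assoc, mul_smul_comm]
    congr 1
    exact mul_comm_of_mul_smul_one_sub (h.centralSum_mul_b i)
  · rw [Puv_eq_centralSum, smul_mul_assoc, mul_smul_comm, h.centralSum_mul_s]
end
end
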